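/- arXiv:1903.10656 — 2 statements merged into one kernel-verified Lean document; each statement's English description precedes it below -/
import Mathlib

section
/- Suppose φ ∈ 𝒮(ℝ^d) satisfies Assumption (φ). For every μ ∈ ℂ \ [0,∞) there is C > 0 such that for all h > 0, ‖(I − P_h* P_h)(H₀ − μ)⁻¹‖_{B(L²(ℝ^d))} ≤ C h², where (H₀ − μ)⁻¹ = 𝓕* M_{(|2πξ|²−μ)⁻¹} 𝓕 is the Fourier multiplier operator with symbol ξ ↦ (|2πξ|² − μ)⁻¹. -/
open MeasureTheory Complex Real
open scoped FourierTransform InnerProductSpace ENNReal ComplexConjugate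

noncomputable section

abbrev Euc (d : ℕ) : Type := EuclideanSpace ℝ (Fin d)
abbrev Zd (d : ℕ) : Type := Fin d → ℤ

instance (d : ℕ) : MeasurableSingletonClass (Zd d) := by
  constructor
  intro f
  have : ({f} : Set (Zd d)) = Set.univ.pi fun j => {f j} := by
    ext g; simp [Set.eq_univ_iff_forall, funext_iff, Set.mem_pi, eq_comm]
  rw [this]
  exact MeasurableSet.univ_pi fun j => measurableSet_singleton _

/-- The measure on `ℤ^d` giving mass `h^d` to each point, so that `L²` of this measure is
`ℓ²(hℤ^d)` with norm `‖v‖_h² = h^d ∑_z |v(hz)|²`. -/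
def latMeas (d : ℕ) (h : ℝ) : Measure (Zd d) := (ENNReal.ofReal (h ^ d)) • Measure.count

/-- `L²(ℝ^d)`. -/
abbrev L2 (d : ℕ) := Lp ℂ 2 (volume : Measure (Euc d))

/-- `ℓ²(hℤ^d)`. -/
abbrev l2h (d : ℕ) (h : ℝ) := Lp ℂ 2 (latMeas d h)

/-- The lattice point `hz ∈ ℝ^d` associated to `z ∈ ℤ^d`. -/
def latPt (d : ℕ) (h : ℝ) (z : Zd d) : Euc d :=
  (EuclideanSpace.equiv (Fin d) ℝ).symm fun j => h * (z j : ℝ)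

/-- The vector in `ℝ^d` associated to `n ∈ ℤ^d`. -/
def latVec (d : ℕ) (n : Zd d) : Euc d :=
  (EuclideanSpace.equiv (Fin d) ℝ).symm fun j => (n j : ℝ)

/-- `P_h : L²(ℝ^d) → ℓ²(hℤ^d)`, `P_h u (z) = h^{−d} ∫ conj(φ(h⁻¹(x−z))) u(x) dx`. -/
def IsProjOp (d : ℕ) (h : ℝ) (φ : SchwartzMap (Euc d) ℂ)
    (Ph : L2 d →L[ℂ] l2h d h) : Prop :=
  ∀ u : L2 d, ∀ z : Zd d,
    (Ph u : Zd d → ℂ) z =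
      (h ^ d : ℂ)⁻¹ * ∫ x, conj (φ (h⁻¹ • (x - latPt d h z))) * (u : Euc d → ℂ) x

local instance unitAddCircleMeasureSpace : MeasureSpace UnitAddCircle := ⟨AddCircle.haarAddCircle⟩

lemma eLpNorm_two_sq {α : Type*} [MeasurableSpace α] {ν : Measure α} (f : α → ℂ) :
    eLpNorm f 2 ν ^ 2 = ∫⁻ x, ‖f x‖ₑ ^ 2 ∂ν := by
  rw [eLpNorm_eq_lintegral_rpow_enorm_toReal (by simp) (by simp),
    ← ENNReal.rpow_natCast, ← ENNReal.rpow_mul]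
  simp

lemma Lp_enorm_sq {α : Type*} [MeasurableSpace α] {ν : Measure α} (f : Lp ℂ 2 ν) :
    ‖f‖ₑ ^ 2 = ∫⁻ x, ‖f x‖ₑ ^ 2 ∂ν := by
  rw [Lp.enorm_def, eLpNorm_two_sq]

/-- The half-open unit cube centred at the integer point `n`. -/
def unitCube {ι : Type*} (n : ι → ℤ) : Set (ι → ℝ) :=
  {x | ∀ i, x i ∈ Set.Ioc ((n i : ℝ) - 1 / 2) ((n i : ℝ) - 1 / 2 + 1)}

/-- The lattice points whose coordinates all lie in `{-1, 0, 1}`. -/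
def nearLattice (ι : Type*) [Fintype ι] [DecidableEq ι] : Finset (ι → ℤ) :=
  Fintype.piFinset fun _ => {-1, 0, 1}

section Cube

variable {ι : Type*} [Fintype ι]

lemma measurableSet_unitCube (n : ι → ℤ) : MeasurableSet (unitCube n) :=
  MeasurableSet.univ_pi' fun _ => measurableSet_Ioc

omit [Fintype ι] in
lemma unitCube_disjoint {n m : ι → ℤ} (h : n ≠ m) : Disjoint (unitCube n) (unitCube m) := by
  rw [Set.disjoint_left]
  intro x hn hm
  apply h
  funext i
  obtain ⟨h1, h2⟩ := hn i
  obtain ⟨h3, h4⟩ := hm i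
  have h5 : (n i : ℝ) < m i + 1 := by linarith
  have h6 : (m i : ℝ) < n i + 1 := by linarith
  have h5' : n i < m i + 1 := by exact_mod_cast h5
  have h6' : m i < n i + 1 := by exact_mod_cast h6
  omega

lemma exists_mem_unitCube [DecidableEq ι] {x : ι → ℝ} (hx : ∀ i, |x i| < 1) :
    ∃ n ∈ nearLattice ι, x ∈ unitCube n := by
  refine ⟨fun i => ⌈x i - 1 / 2⌉, ?_, fun i => ⟨?_, ?_⟩⟩
  · rw [nearLattice, Fintype.mem_piFinset]
    intro i
    obtain ⟨h1, h2⟩ := abs_lt.1 (hx i)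
    have h3 : -2 < ⌈x i - 1 / 2⌉ := by rw [Int.lt_ceil]; push_cast; linarith
    have h4 : ⌈x i - 1 / 2⌉ ≤ 1 := by rw [Int.ceil_le]; push_cast; linarith
    simp only [Finset.mem_insert, Finset.mem_singleton]
    omega
  · have := Int.ceil_lt_add_one (x i - 1 / 2)
    linarith
  · have := Int.le_ceil (x i - 1 / 2)
    linarith

omit [Fintype ι] in
lemma preimage_add_unitCube (n : ι → ℤ) :
    (fun x : ι → ℝ => x + fun i => (n i : ℝ)) ⁻¹' unitCube n = unitCube 0 := by
  ext x
  simp only [unitCube, Set.mem_preimage, Set.mem_ofPred_eq, Set.mem_Ioc, Pi.add_apply,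
    Pi.zero_apply, Int.cast_zero]
  refine forall_congr' fun i => ?_
  constructor <;> rintro ⟨h1, h2⟩ <;> constructor <;> linarith

lemma restrict_unitCube_map (n : ι → ℤ) :
    MeasurePreserving (fun x : ι → ℝ => x + fun i => (n i : ℝ))
      (volume.restrict (unitCube 0)) (volume.restrict (unitCube n)) := by
  rw [← preimage_add_unitCube n]
  exact (measurePreserving_add_right volume _).restrict_preimage (measurableSet_unitCube n)

lemma support_subset_iUnion_unitCube [DecidableEq ι] {E : Type*} [Zero E] {F : (ι → ℝ) → E}
    (hF : ∀ x, F x ≠ 0 → ∀ i, |x i| < 1) :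
    Function.support F ⊆ ⋃ n ∈ nearLattice ι, unitCube n := by
  intro x hx
  simpa using exists_mem_unitCube (hF x hx)

lemma integral_eq_sum_unitCube [DecidableEq ι] {F : (ι → ℝ) → ℂ} (hi : Integrable F)
    (hF : ∀ x, F x ≠ 0 → ∀ i, |x i| < 1) :
    ∫ x, F x = ∑ n ∈ nearLattice ι, ∫ x in unitCube 0, F (x + fun i => (n i : ℝ)) := by
  rw [← setIntegral_eq_integral_of_forall_compl_eq_zero
    (s := ⋃ n ∈ nearLattice ι, unitCube n) (f := F),
    integral_biUnion_finset _ (fun n _ => measurableSet_unitCube n)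
      (fun n _ m _ h => unitCube_disjoint h) (fun n _ => hi.integrableOn)]
  · refine Finset.sum_congr rfl fun n _ => ?_
    exact ((restrict_unitCube_map n).integral_comp
      (MeasurableEquiv.addRight _).measurableEmbedding F).symm
  · intro x hx
    by_contra h
    exact hx (support_subset_iUnion_unitCube hF h)

lemma sum_lintegral_unitCube_le [DecidableEq ι] (F : (ι → ℝ) → ℝ≥0∞) :
    ∑ n ∈ nearLattice ι, ∫⁻ x in unitCube 0, F (x + fun i => (n i : ℝ)) ≤ ∫⁻ x, F x := by
  calc _ = ∑ n ∈ nearLattice ι, ∫⁻ x in unitCube n, F x :=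
        Finset.sum_congr rfl fun n _ => (restrict_unitCube_map n).lintegral_comp_emb
          (MeasurableEquiv.addRight _).measurableEmbedding F
    _ = ∫⁻ x in ⋃ n ∈ nearLattice ι, unitCube n, F x :=
        (lintegral_biUnion_finset (fun n _ m _ h => unitCube_disjoint h)
          (fun n _ => measurableSet_unitCube n) F).symm
    _ ≤ _ := setLIntegral_le_lintegral _ _

/-- The unit cube section of the projection `ℝ^ι → (ℝ/ℤ)^ι`. -/
def torusSection (t : UnitAddTorus ι) : ι → ℝ :=
  (UnitAddTorus.measurableEquivPiIoc (fun _ => -1 / 2) t).1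

omit [Fintype ι] in
lemma unitCube_zero :
    (unitCube 0 : Set (ι → ℝ)) = {x | ∀ i, x i ∈ Set.Ioc (-1 / 2 : ℝ) (-1 / 2 + 1)} := by
  ext x
  simp [unitCube, neg_div]

lemma measurePreserving_torusSection :
    MeasurePreserving (torusSection (ι := ι)) volume (volume.restrict (unitCube 0)) := by
  have hm := measurableSet_unitCube (0 : ι → ℤ)
  rw [unitCube_zero] at hm ⊢
  exact (measurePreserving_subtype_coe hm).comp
    (UnitAddTorus.measurePreserving_equivPiIoc (fun _ => -1 / 2))

omit [Fintype ι] in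
lemma torusSection_coe {x : ι → ℝ} (hx : x ∈ unitCube 0) :
    torusSection (fun i => (x i : UnitAddCircle)) = x := by
  rw [unitCube_zero] at hx
  exact congrArg Subtype.val
    ((UnitAddTorus.measurableEquivPiIoc (fun _ => -1 / 2)).apply_symm_apply ⟨x, hx⟩)

lemma mFourier_coe (n : ι → ℤ) (x : ι → ℝ) :
    UnitAddTorus.mFourier n (fun i => (x i : UnitAddCircle)) =
      exp (2 * π * I * ∑ i, (n i : ℂ) * x i) := by
  simp only [UnitAddTorus.mFourier, ContinuousMap.coe_mk, fourier_coe_apply, ← Complex.exp_sum,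
    Finset.mul_sum]
  congr 1
  refine Finset.sum_congr rfl fun i _ => ?_
  push_cast
  ring

/-- Parseval's identity on the unit cube. -/
lemma tsum_enorm_sq_integral_unitCube {G : (ι → ℝ) → ℂ}
    (hG : MemLp G 2 (volume.restrict (unitCube 0))) :
    ∑' z : ι → ℤ, ‖∫ x in unitCube 0, exp (2 * π * I * ∑ i, (z i : ℂ) * x i) * G x‖ₑ ^ 2 =
      ∫⁻ x in unitCube 0, ‖G x‖ₑ ^ 2 := by
  have hF : MemLp (G ∘ torusSection) 2 (volume : Measure (UnitAddTorus ι)) :=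
    hG.comp_measurePreserving measurePreserving_torusSection
  have key := UnitAddTorus.hasSum_sq_mFourierCoeff (hF.toLp _)
  have hc : ∀ n, UnitAddTorus.mFourierCoeff (hF.toLp _) (-n) =
      ∫ x in unitCube 0, exp (2 * π * I * ∑ i, (n i : ℂ) * x i) * G x := by
    intro n
    have h1 : UnitAddTorus.mFourierCoeff (hF.toLp _) (-n) =
        UnitAddTorus.mFourierCoeff (G ∘ torusSection) (-n) := by
      refine integral_congr_ae ?_
      filter_upwards [hF.coeFn_toLp] with t ht
      rw [ht]
    rw [h1, UnitAddTorus.mFourierCoeff_eq_integral _ _ (fun _ => -1 / 2), ← unitCube_zero]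
    refine setIntegral_congr_fun (measurableSet_unitCube 0) fun x hx => ?_
    simp only [Function.comp_apply, torusSection_coe hx, neg_neg, mFourier_coe, smul_eq_mul]
  rw [← (Equiv.neg (ι → ℤ)).hasSum_iff] at key
  have key' : HasSum (fun z : ι → ℤ =>
      ‖∫ x in unitCube 0, exp (2 * π * I * ∑ i, (z i : ℂ) * x i) * G x‖ ^ 2)
      (∫ t, ‖hF.toLp _ t‖ ^ 2) := by
    refine key.congr_fun fun z => ?_
    rw [Function.comp_apply, Equiv.neg_apply, hc]
  have hi : Integrable (fun t => ‖hF.toLp _ t‖ ^ 2) :=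
    (memLp_two_iff_integrable_sq_norm (Lp.aestronglyMeasurable _)).1 (Lp.memLp _)
  calc _ = ENNReal.ofReal (∫ t, ‖hF.toLp _ t‖ ^ 2) := by
        rw [← key'.tsum_eq, ENNReal.ofReal_tsum_of_nonneg (fun _ => by positivity) key'.summable]
        simp only [ENNReal.ofReal_pow (norm_nonneg _), ofReal_norm]
    _ = ∫⁻ t, ‖hF.toLp _ t‖ₑ ^ 2 := by
        rw [ofReal_integral_eq_lintegral_ofReal hi (.of_forall fun _ => by positivity)]
        simp only [ENNReal.ofReal_pow (norm_nonneg _), ofReal_norm]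
    _ = _ := by
        rw [← Lp_enorm_sq, Lp.enorm_toLp,
          eLpNorm_comp_measurePreserving hG.1 measurePreserving_torusSection, eLpNorm_two_sq]

/-- Parseval's identity for the periodization of a function supported in `(-1, 1)^ι`. -/
lemma tsum_enorm_sq_integral_eq [DecidableEq ι] {g : (ι → ℝ) → ℂ} (hg : MemLp g 2)
    (hi : Integrable g) (hs : ∀ x, g x ≠ 0 → ∀ i, |x i| < 1) :
    ∑' z : ι → ℤ, ‖∫ x, exp (2 * π * I * ∑ i, (z i : ℂ) * x i) * g x‖ₑ ^ 2 =
      ∫⁻ x in unitCube 0, ‖∑ n ∈ nearLattice ι, g (x + fun i => (n i : ℝ))‖ₑ ^ 2 := by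
  have hG : MemLp (fun x => ∑ n ∈ nearLattice ι, g (x + fun i => (n i : ℝ))) 2
      (volume.restrict (unitCube 0)) :=
    memLp_finsetSum _ fun n _ => hg.restrict (unitCube n) |>.comp_measurePreserving
      (restrict_unitCube_map n)
  rw [← tsum_enorm_sq_integral_unitCube hG]
  have hint : ∀ z : ι → ℤ,
      Integrable (fun x : ι → ℝ => exp (2 * π * I * ∑ i, (z i : ℂ) * x i) * g x) := by
    intro z
    refine hi.bdd_mul (c := 1) (Continuous.aestronglyMeasurable (by fun_prop))
      (.of_forall fun x => le_of_eq ?_)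
    rw [show 2 * π * I * ∑ i, (z i : ℂ) * x i = (2 * π * ∑ i, z i * x i : ℝ) * I by
      push_cast; ring, norm_exp_ofReal_mul_I]
  refine tsum_congr fun z => ?_
  congr 2
  rw [integral_eq_sum_unitCube (hint z) (fun x hx => hs x (right_ne_zero_of_mul hx)),
    ← integral_finsetSum]
  · refine integral_congr_ae (.of_forall fun x => ?_)
    dsimp only
    rw [Finset.mul_sum]
    refine Finset.sum_congr rfl fun n _ => ?_
    congr 1
    have : 2 * π * I * ∑ i, (z i : ℂ) * ((x + fun i => (n i : ℝ)) i : ℝ) =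
        2 * π * I * ∑ i, (z i : ℂ) * x i + (∑ i, z i * n i : ℤ) * (2 * π * I) := by
      simp only [Pi.add_apply, ofReal_add, mul_add, Finset.sum_add_distrib]
      push_cast
      ring
    rw [this]
    exact Complex.exp_periodic.int_mul _ _
  · intro n _
    exact ((restrict_unitCube_map n).integrable_comp_emb
      (MeasurableEquiv.addRight _).measurableEmbedding).2 (hint z).integrableOn

end Cube

lemma summable_of_tsum_eq_one {κ : Type*} {f : κ → ℝ} (hf : ∑' n, f n = 1) : Summable f := by
  by_contra h
  rw [tsum_eq_zero_of_not_summable h] at hf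
  exact zero_ne_one hf

lemma enorm_sum_mul_sq_le {κ : Type*} (s : Finset κ) (a w : κ → ℂ)
    (ha : ∑ n ∈ s, ‖a n‖ ^ 2 ≤ 1) :
    ‖∑ n ∈ s, a n * w n‖ₑ ^ 2 ≤ ∑ n ∈ s, ‖w n‖ₑ ^ 2 := by
  have h : ‖∑ n ∈ s, a n * w n‖ ^ 2 ≤ ∑ n ∈ s, ‖w n‖ ^ 2 := by
    calc ‖∑ n ∈ s, a n * w n‖ ^ 2 ≤ (∑ n ∈ s, ‖a n‖ * ‖w n‖) ^ 2 := by
          gcongr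
          exact (norm_sum_le _ _).trans_eq (by simp only [norm_mul])
      _ ≤ (∑ n ∈ s, ‖a n‖ ^ 2) * ∑ n ∈ s, ‖w n‖ ^ 2 := Finset.sum_mul_sq_le_sq_mul_sq _ _ _
      _ ≤ 1 * ∑ n ∈ s, ‖w n‖ ^ 2 := by gcongr
      _ = _ := one_mul _
  have := ENNReal.ofReal_le_ofReal h
  rw [ENNReal.ofReal_sum_of_nonneg fun _ _ => by positivity] at this
  simpa only [ENNReal.ofReal_pow (norm_nonneg _), ofReal_norm] using this

section Lattice

variable {d : ℕ}

lemma toLp_add_intCast (x : Fin d → ℝ) (n : Zd d) :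
    WithLp.toLp 2 (x + fun i => (n i : ℝ)) = (WithLp.toLp 2 x : Euc d) + latVec d n := rfl

lemma inner_latVec (z : Zd d) (x : Fin d → ℝ) :
    ⟪latVec d z, WithLp.toLp 2 x⟫_ℝ = ∑ i, (z i : ℝ) * x i := by
  simp [latVec, PiLp.inner_apply, mul_comm]

/-- Parseval's identity for the periodization of a function on `ℝ^d` supported in `(-1, 1)^d`. -/
lemma tsum_enorm_sq_integral_exp_inner {g : Euc d → ℂ} (hg : MemLp g 2) (hi : Integrable g)
    (hs : ∀ x, g x ≠ 0 → ∀ i, |x i| < 1) :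
    ∑' z : Zd d, ‖∫ x, exp (2 * π * I * (⟪latVec d z, x⟫_ℝ : ℂ)) * g x‖ₑ ^ 2 =
      ∫⁻ x in unitCube 0, ‖∑ n ∈ nearLattice (Fin d), g (WithLp.toLp 2 x + latVec d n)‖ₑ ^ 2 := by
  have hp := PiLp.volume_preserving_toLp (Fin d)
  have he : MeasurableEmbedding (WithLp.toLp 2 : (Fin d → ℝ) → Euc d) :=
    (MeasurableEquiv.toLp 2 (Fin d → ℝ)).measurableEmbedding
  have := tsum_enorm_sq_integral_eq (hg.comp_measurePreserving hp)
    ((hp.integrable_comp_emb he).2 hi) (fun x hx => hs _ hx)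
  simp only [Function.comp_apply, toLp_add_intCast] at this
  rw [← this]
  refine tsum_congr fun z => ?_
  rw [← hp.integral_comp he]
  simp only [inner_latVec]
  push_cast
  rfl

lemma tsum_enorm_sq_integral_exp_inner_le {a w : Euc d → ℂ}
    (hw : AEStronglyMeasurable w) (hg : MemLp (fun x => a x * w x) 2)
    (hi : Integrable (fun x => a x * w x))
    (ha : ∀ x, ∑' n : Zd d, ‖a (x + latVec d n)‖ ^ 2 = 1)
    (hs : ∀ x, a x ≠ 0 → ∀ i, |x i| < 1) :
    ∑' z : Zd d, ‖∫ x, exp (2 * π * I * (⟪latVec d z, x⟫_ℝ : ℂ)) * (a x * w x)‖ₑ ^ 2 ≤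
      ∫⁻ x, ‖w x‖ₑ ^ 2 := by
  have hp := PiLp.volume_preserving_toLp (Fin d)
  have he : MeasurableEmbedding (WithLp.toLp 2 : (Fin d → ℝ) → Euc d) :=
    (MeasurableEquiv.toLp 2 (Fin d → ℝ)).measurableEmbedding
  rw [tsum_enorm_sq_integral_exp_inner hg hi fun x hx => hs x (left_ne_zero_of_mul hx),
    ← hp.lintegral_comp_emb he]
  refine le_trans ?_ (sum_lintegral_unitCube_le fun x => ‖w (WithLp.toLp 2 x)‖ₑ ^ 2)
  have hm : ∀ n ∈ nearLattice (Fin d), AEMeasurable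
      (fun x => ‖w (WithLp.toLp 2 (x + fun i => (n i : ℝ)))‖ₑ ^ 2)
      (volume.restrict (unitCube 0)) := fun n _ =>
    ((hw.comp_measurePreserving hp).restrict.comp_measurePreserving
      (restrict_unitCube_map n)).enorm.pow_const 2
  rw [← lintegral_finsetSum' _ hm]
  refine lintegral_mono fun x => enorm_sum_mul_sq_le _ _ _ ?_
  exact ((summable_of_tsum_eq_one (ha _)).sum_le_tsum _ fun _ _ => by positivity).trans_eq (ha _)

lemma tsum_enorm_sq_integral_exp_inner_of_support {g : Euc d → ℂ} (hg : MemLp g 2)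
    (hi : Integrable g) (hs : ∀ x, g x ≠ 0 → ∀ i, |x i| < 1 / 2) :
    ∑' z : Zd d, ‖∫ x, exp (2 * π * I * (⟪latVec d z, x⟫_ℝ : ℂ)) * g x‖ₑ ^ 2 =
      ∫⁻ x, ‖g x‖ₑ ^ 2 := by
  have hp := PiLp.volume_preserving_toLp (Fin d)
  have he : MeasurableEmbedding (WithLp.toLp 2 : (Fin d → ℝ) → Euc d) :=
    (MeasurableEquiv.toLp 2 (Fin d → ℝ)).measurableEmbedding
  have hcube : ∀ x : Fin d → ℝ, g (WithLp.toLp 2 x) ≠ 0 → x ∈ unitCube 0 := by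
    intro x hx i
    obtain ⟨h1, h2⟩ := abs_lt.1 (hs _ hx i)
    dsimp only at h1 h2
    constructor <;> simp only [Pi.zero_apply, Int.cast_zero] <;> linarith
  rw [tsum_enorm_sq_integral_exp_inner hg hi fun x hx i => (hs x hx i).trans (by norm_num),
    ← hp.lintegral_comp_emb he, ← setLIntegral_eq_of_support_subset
      (s := unitCube 0) (f := fun x => ‖g (WithLp.toLp 2 x)‖ₑ ^ 2)]
  · refine setLIntegral_congr_fun (measurableSet_unitCube (0 : Fin d → ℤ)) fun x hx => ?_
    dsimp only
    rw [Finset.sum_eq_single 0]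
    · simp [latVec, ← Pi.zero_def]
    · intro n _ hn
      by_contra h
      have h1 := hcube (x + fun i => (n i : ℝ)) h
      rw [← preimage_add_unitCube n] at hx
      exact Set.disjoint_left.1 (unitCube_disjoint hn) hx h1
    · intro h
      exact (h (by simp [nearLattice])).elim
  · intro x hx
    exact hcube x fun h => hx (by simp [h])

lemma lintegral_comp_inv_smul {h : ℝ} (hh : 0 < h) (F : Euc d → ℝ≥0∞) :
    ∫⁻ x, F (h⁻¹ • x) = ENNReal.ofReal (h ^ d) * ∫⁻ x, F x := by
  have he : MeasurableEmbedding (fun x : Euc d => h⁻¹ • x) :=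
    (Homeomorph.smulOfNeZero h⁻¹ (inv_pos.2 hh).ne').measurableEmbedding
  rw [← he.lintegral_map, Measure.map_addHaar_smul _ (inv_pos.2 hh).ne', lintegral_smul_measure]
  simp [abs_of_pos hh]

lemma memLp_comp_inv_smul {h : ℝ} (hh : 0 < h) {w : Euc d → ℂ} (hw : MemLp w 2) :
    MemLp (fun x => w (h⁻¹ • x)) 2 := by
  have he : MeasurableEmbedding (fun x : Euc d => h⁻¹ • x) :=
    (Homeomorph.smulOfNeZero h⁻¹ (inv_pos.2 hh).ne').measurableEmbedding
  refine (he.memLp_map_measure_iff (g := w)).1 ?_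
  rw [Measure.map_addHaar_smul _ (inv_pos.2 hh).ne']
  exact hw.smul_measure ENNReal.ofReal_ne_top

lemma exists_norm_eq_one {a : Euc d → ℂ} (ha : ∀ x, ∑' n : Zd d, ‖a (x + latVec d n)‖ ^ 2 = 1)
    (hs : tsupport a ⊆ {ξ : Euc d | ∀ j, ξ j ∈ Set.Ioo (-1 : ℝ) 1}) :
    ∃ δ > 0, δ ≤ 1 / 2 ∧ ∀ ξ, ‖ξ‖ < δ → ‖a ξ‖ = 1 := by
  have hev : ∀ᶠ ξ in nhds (0 : Euc d),
      ∀ n ∈ (nearLattice (Fin d)).erase 0, ξ + latVec d n ∉ tsupport a := by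
    rw [Filter.eventually_all_finset]
    intro n hn
    have hcont : Filter.Tendsto (fun ξ : Euc d => ξ + latVec d n) (nhds 0)
        (nhds (0 + latVec d n)) := Continuous.tendsto (by fun_prop) 0
    refine hcont.eventually ((isClosed_tsupport a).isOpen_compl.mem_nhds fun hmem => ?_)
    rw [zero_add] at hmem
    obtain ⟨hn0, -⟩ := Finset.mem_erase.1 hn
    refine hn0 (funext fun j => ?_)
    obtain ⟨h1, h2⟩ := hs hmem j
    have h1' : (-1 : ℝ) < n j := h1
    have h2' : (n j : ℝ) < 1 := h2
    have h3 : -1 < n j := by exact_mod_cast h1'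
    have h4 : n j < 1 := by exact_mod_cast h2'
    simp only [Pi.zero_apply]
    omega
  obtain ⟨ε, hε, hball⟩ := Metric.eventually_nhds_iff.1 hev
  refine ⟨min ε (1 / 2), by positivity, min_le_right _ _, fun ξ hξ => ?_⟩
  have hz : ∀ n : Zd d, n ≠ 0 → a (ξ + latVec d n) = 0 := by
    intro n hn
    by_contra hne
    have hmem := subset_tsupport a hne
    refine hball (y := ξ) (by simpa using hξ.trans_le (min_le_left _ _)) n
      (Finset.mem_erase.2 ⟨hn, Fintype.mem_piFinset.2 fun j => ?_⟩) hmem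
    obtain ⟨h1, h2⟩ := hs hmem j
    have h5 : |ξ j| ≤ ‖ξ‖ := PiLp.norm_apply_le ξ j
    obtain ⟨h6, h7⟩ := abs_lt.1 (h5.trans_lt (hξ.trans_le (min_le_right _ _)))
    have h1' : (-1 : ℝ) < ξ j + n j := h1
    have h2' : ξ j + n j < (1 : ℝ) := h2
    have h3 : (-2 : ℝ) < n j := by linarith
    have h4 : (n j : ℝ) < 2 := by linarith
    have h3' : -2 < n j := by exact_mod_cast h3
    have h4' : n j < 2 := by exact_mod_cast h4
    simp only [Finset.mem_insert, Finset.mem_singleton]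
    omega
  have h0 := ha ξ
  rw [tsum_eq_single 0 fun n hn => by simp [hz n hn]] at h0
  have hv : latVec d 0 = 0 := by ext; simp [latVec]
  rw [hv, add_zero] at h0
  nlinarith [norm_nonneg (a ξ)]

end Lattice

section Projection

variable {d : ℕ}

lemma lintegral_latMeas (h : ℝ) (F : Zd d → ℝ≥0∞) :
    ∫⁻ z, F z ∂latMeas d h = ENNReal.ofReal (h ^ d) * ∑' z, F z := by
  rw [latMeas, lintegral_smul_measure, lintegral_count, smul_eq_mul]

lemma fourier_comp_inv_smul_sub {h : ℝ} (hh : 0 < h) (φ : Euc d → ℂ) (a ξ : Euc d) :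
    𝓕 (fun x => φ (h⁻¹ • (x - a))) ξ =
      (h ^ d : ℂ) * (exp (-(2 * π * I * (⟪a, ξ⟫_ℝ : ℂ))) * 𝓕 φ (h • ξ)) := by
  have h1 := integral_sub_right_eq_self (μ := volume)
    (fun x => exp (↑(-2 * π * ⟪x + a, ξ⟫_ℝ) * I) • φ (h⁻¹ • x)) a
  have h2 := Measure.integral_comp_inv_smul_of_nonneg (volume : Measure (Euc d))
    (fun x => exp (-(2 * π * I * (⟪a, ξ⟫_ℝ : ℂ))) *
      (exp (↑(-2 * π * ⟪x, h • ξ⟫_ℝ) * I) • φ x)) hh.le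
  rw [integral_const_mul _ fun x => exp (↑(-2 * π * ⟪x, h • ξ⟫_ℝ) * I) • φ x,
    finrank_euclideanSpace_fin, Complex.real_smul, ofReal_pow] at h2
  rw [Real.fourier_eq', Real.fourier_eq']
  simp only [sub_add_cancel] at h1
  rw [h1, ← h2]
  refine integral_congr_ae (.of_forall fun x => ?_)
  simp only [smul_eq_mul]
  rw [← mul_assoc, ← Complex.exp_add, inner_add_left, real_inner_smul_left, real_inner_smul_right]
  have hh' : (h : ℂ) ≠ 0 := by exact_mod_cast hh.ne'
  congr 2
  push_cast
  field_simp
  ring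

lemma integral_conj_mul_eq_fourier (ψ : SchwartzMap (Euc d) ℂ) (u : L2 d) :
    ∫ x, conj (ψ x) * u x = ∫ ξ, conj (𝓕 ⇑ψ ξ) * (𝓕 u : L2 d) ξ := by
  have key := Lp.inner_fourier_eq (ψ.toLp 2) u
  rw [SchwartzMap.toLp_fourier_eq, L2.inner_def, L2.inner_def] at key
  convert key.symm using 1
  · refine integral_congr_ae ?_
    filter_upwards [ψ.coeFn_toLp 2] with x hx
    rw [hx, RCLike.inner_apply, mul_comm]
  · refine integral_congr_ae ?_
    filter_upwards [(𝓕 ψ).coeFn_toLp 2] with x hx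
    rw [hx, RCLike.inner_apply, mul_comm, SchwartzMap.fourier_coe]

lemma projOp_apply {h : ℝ} (hh : 0 < h) {φ : SchwartzMap (Euc d) ℂ} {Ph : L2 d →L[ℂ] l2h d h}
    (hP : IsProjOp d h φ Ph) (u : L2 d) (z : Zd d) :
    Ph u z = (h ^ d : ℂ)⁻¹ * ∫ ξ, exp (2 * π * I * (⟪latVec d z, ξ⟫_ℝ : ℂ)) *
      (conj (𝓕 ⇑φ ξ) * (𝓕 u : L2 d) (h⁻¹ • ξ)) := by
  have hh' : (h : ℂ) ≠ 0 := by exact_mod_cast hh.ne'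
  let e : Euc d ≃L[ℝ] Euc d := ContinuousLinearEquiv.smulLeft (Units.mk0 h⁻¹ (inv_pos.2 hh).ne')
  let ψ : SchwartzMap (Euc d) ℂ := SchwartzMap.compSubConstCLM ℂ (latPt d h z)
    (SchwartzMap.compCLMOfContinuousLinearEquiv ℂ e φ)
  have hψ : ⇑ψ = fun x => φ (h⁻¹ • (x - latPt d h z)) := rfl
  have hpt : latPt d h z = h • latVec d z := rfl
  have h1 := integral_conj_mul_eq_fourier ψ u
  have h2 := Measure.integral_comp_inv_smul_of_nonneg (volume : Measure (Euc d))
    (fun ξ => exp (2 * π * I * (⟪latVec d z, h • ξ⟫_ℝ : ℂ)) *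
      (conj (𝓕 ⇑φ (h • ξ)) * (𝓕 u : L2 d) ξ)) hh.le
  simp only [smul_inv_smul₀ hh.ne'] at h2
  rw [hP u z, h2]
  rw [hψ] at h1
  rw [h1, finrank_euclideanSpace_fin, Complex.real_smul, ofReal_pow,
    inv_mul_cancel_left₀ (pow_ne_zero d hh'), ← integral_const_mul]
  refine integral_congr_ae (.of_forall fun ξ => ?_)
  simp only
  rw [fourier_comp_inv_smul_sub hh, hpt, real_inner_smul_left, real_inner_smul_right]
  simp only [map_mul, map_pow, Complex.conj_ofReal, ← Complex.exp_conj, map_neg, Complex.conj_I,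
    map_ofNat]
  rw [show -(2 * π * -I * ((h * ⟪latVec d z, ξ⟫_ℝ : ℝ) : ℂ)) =
    2 * π * I * ((h * ⟪latVec d z, ξ⟫_ℝ : ℝ) : ℂ) by ring,
    mul_assoc, inv_mul_cancel_left₀ (pow_ne_zero d hh'), mul_assoc]

lemma enorm_sq_projOp {h : ℝ} (hh : 0 < h) {φ : SchwartzMap (Euc d) ℂ} {Ph : L2 d →L[ℂ] l2h d h}
    (hP : IsProjOp d h φ Ph) (u : L2 d) :
    ‖Ph u‖ₑ ^ 2 = (ENNReal.ofReal (h ^ d))⁻¹ *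
      ∑' z, ‖∫ ξ, exp (2 * π * I * (⟪latVec d z, ξ⟫_ℝ : ℂ)) *
        (conj (𝓕 ⇑φ ξ) * (𝓕 u : L2 d) (h⁻¹ • ξ))‖ₑ ^ 2 := by
  have hc : ‖((h : ℂ) ^ d)⁻¹‖ₑ = (ENNReal.ofReal (h ^ d))⁻¹ := by
    rw [← ofReal_norm, norm_inv, norm_pow, Complex.norm_real, Real.norm_of_nonneg hh.le,
      ENNReal.ofReal_inv_of_pos (by positivity)]
  have h0 : ENNReal.ofReal (h ^ d) ≠ 0 := by simp [hh]
  rw [Lp_enorm_sq, lintegral_latMeas]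
  simp only [projOp_apply hh hP, enorm_mul, mul_pow, hc]
  rw [ENNReal.tsum_mul_left, ← mul_assoc, sq, ← mul_assoc,
    ENNReal.mul_inv_cancel h0 ENNReal.ofReal_ne_top, one_mul]

lemma norm_le_one_of_tsum {a : Euc d → ℂ} (ha : ∀ x, ∑' n : Zd d, ‖a (x + latVec d n)‖ ^ 2 = 1)
    (x : Euc d) : ‖a x‖ ≤ 1 := by
  have h0 := ((summable_of_tsum_eq_one (ha x)).le_tsum 0 fun _ _ => by positivity).trans_eq (ha x)
  have hv : latVec d 0 = 0 := by ext; simp [latVec]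
  rw [hv, add_zero] at h0
  exact (sq_le_one_iff₀ (norm_nonneg _)).1 h0

lemma memLp_conj_fourier_mul {φ : SchwartzMap (Euc d) ℂ}
    (hφ : ∀ ξ : Euc d, ∑' n : Zd d, ‖𝓕 ⇑φ (ξ + latVec d n)‖ ^ 2 = 1)
    {w : Euc d → ℂ} (hw : MemLp w 2) :
    MemLp (fun ξ => conj (𝓕 ⇑φ ξ) * w ξ) 2 ∧ Integrable (fun ξ => conj (𝓕 ⇑φ ξ) * w ξ) := by
  have hc : MemLp (fun ξ => conj (𝓕 ⇑φ ξ)) 2 := by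
    have := ((𝓕 φ).memLp 2 (volume : Measure (Euc d))).star
    rwa [SchwartzMap.fourier_coe] at this
  refine ⟨hw.mono (hc.1.mul hw.1) (.of_forall fun ξ => ?_), hc.integrable_mul hw⟩
  rw [norm_mul, RCLike.norm_conj]
  exact mul_le_of_le_one_left (norm_nonneg _) (norm_le_one_of_tsum hφ ξ)

lemma norm_projOp_le {h : ℝ} (hh : 0 < h) {φ : SchwartzMap (Euc d) ℂ}
    (hφ1 : ∀ ξ : Euc d, ∑' n : Zd d, ‖𝓕 ⇑φ (ξ + latVec d n)‖ ^ 2 = 1)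
    (hφ2 : tsupport (𝓕 ⇑φ) ⊆ {ξ : Euc d | ∀ j, ξ j ∈ Set.Ioo (-1 : ℝ) 1})
    {Ph : L2 d →L[ℂ] l2h d h} (hP : IsProjOp d h φ Ph) (u : L2 d) : ‖Ph u‖ ≤ ‖u‖ := by
  have hw := memLp_comp_inv_smul hh (Lp.memLp (𝓕 u : L2 d))
  obtain ⟨hg, hi⟩ := memLp_conj_fourier_mul hφ1 hw
  have h0 : ENNReal.ofReal (h ^ d) ≠ 0 := by simp [hh]
  rw [← Lp.norm_fourier_eq u, ← enorm_le_iff_norm_le, ← ENNReal.pow_le_pow_left_iff two_ne_zero,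
    enorm_sq_projOp hh hP, Lp_enorm_sq (𝓕 u), ENNReal.inv_mul_le_iff h0 ENNReal.ofReal_ne_top,
    ← lintegral_comp_inv_smul hh]
  refine tsum_enorm_sq_integral_exp_inner_le hw.1 hg hi (fun x => by simpa using hφ1 x)
    fun x hx i => abs_lt.2 (hφ2 (subset_tsupport _ fun h => hx ?_) i)
  rw [h, map_zero]

lemma norm_projOp_eq {h : ℝ} (hh : 0 < h) {φ : SchwartzMap (Euc d) ℂ}
    (hφ1 : ∀ ξ : Euc d, ∑' n : Zd d, ‖𝓕 ⇑φ (ξ + latVec d n)‖ ^ 2 = 1)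
    {δ : ℝ} (hδ : δ ≤ 1 / 2) (hφ : ∀ ξ : Euc d, ‖ξ‖ < δ → ‖𝓕 ⇑φ ξ‖ = 1)
    {Ph : L2 d →L[ℂ] l2h d h} (hP : IsProjOp d h φ Ph) {u : L2 d}
    (hu : ∀ᵐ ξ, δ ≤ ‖h • ξ‖ → (𝓕 u : L2 d) ξ = 0) : ‖Ph u‖ = ‖u‖ := by
  have hw := memLp_comp_inv_smul hh (Lp.memLp (𝓕 u : L2 d))
  have hq : Measure.QuasiMeasurePreserving (fun x : Euc d => h⁻¹ • x) := by
    refine ⟨measurable_const_smul _, ?_⟩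
    rw [Measure.map_addHaar_smul _ (inv_pos.2 hh).ne']
    exact Measure.smul_absolutelyContinuous
  let g : Euc d → ℂ := (Metric.ball 0 δ).indicator fun ξ => (𝓕 u : L2 d) (h⁻¹ • ξ)
  have hg : (fun ξ => (𝓕 u : L2 d) (h⁻¹ • ξ)) =ᵐ[volume] g := by
    filter_upwards [hq.ae hu] with ξ hξ
    rw [smul_inv_smul₀ hh.ne'] at hξ
    by_cases hb : ξ ∈ Metric.ball 0 δ
    · simp only [g, Set.indicator_of_mem hb]
    · rw [hξ (by simpa using hb)]
      simp only [g, Set.indicator_of_notMem hb]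
  obtain ⟨hg2, hi⟩ := memLp_conj_fourier_mul hφ1 ((memLp_congr_ae hg).1 hw)
  have h0 : ENNReal.ofReal (h ^ d) ≠ 0 := by simp [hh]
  rw [← Lp.norm_fourier_eq u, ← toReal_enorm, ← toReal_enorm (𝓕 u)]
  congr 1
  refine (ENNReal.pow_right_strictMono two_ne_zero).injective ?_
  have hint : ∀ z : Zd d, ∫ ξ, exp (2 * π * I * (⟪latVec d z, ξ⟫_ℝ : ℂ)) *
        (conj (𝓕 ⇑φ ξ) * (𝓕 u : L2 d) (h⁻¹ • ξ)) =
      ∫ ξ, exp (2 * π * I * (⟪latVec d z, ξ⟫_ℝ : ℂ)) * (conj (𝓕 ⇑φ ξ) * g ξ) := fun z =>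
    integral_congr_ae (hg.mono fun ξ hξ => by simp only [hξ])
  rw [enorm_sq_projOp hh hP, Lp_enorm_sq (𝓕 u)]
  simp only [hint]
  rw [tsum_enorm_sq_integral_exp_inner_of_support hg2 hi,
    ← ENNReal.mul_right_inj h0 ENNReal.ofReal_ne_top, ← mul_assoc,
    ENNReal.mul_inv_cancel h0 ENNReal.ofReal_ne_top, one_mul, ← lintegral_comp_inv_smul hh]
  · refine lintegral_congr_ae (hg.mono fun ξ hξ => ?_)
    simp only [hξ, g]
    by_cases hb : ξ ∈ Metric.ball 0 δ
    · rw [enorm_mul, ← ofReal_norm (conj _), RCLike.norm_conj, hφ ξ (by simpa using hb),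
        ENNReal.ofReal_one, one_mul]
    · simp [Set.indicator_of_notMem hb]
  · intro ξ hξ i
    have hb : ξ ∈ Metric.ball 0 δ := by
      by_contra hb
      exact hξ (by simp [g, Set.indicator_of_notMem hb])
    exact (PiLp.norm_apply_le ξ i).trans_lt ((mem_ball_zero_iff.1 hb).trans_le hδ)

end Projection

lemma norm_sub_adjoint_apply_sq_le {E F : Type*} [NormedAddCommGroup E] [InnerProductSpace ℂ E]
    [CompleteSpace E] [NormedAddCommGroup F] [InnerProductSpace ℂ F] [CompleteSpace F]
    {P : E →L[ℂ] F} (hP : ∀ u, ‖P u‖ ≤ ‖u‖) (u : E) :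
    ‖u - ContinuousLinearMap.adjoint P (P u)‖ ^ 2 ≤ ‖u‖ ^ 2 - ‖P u‖ ^ 2 := by
  have h1 : ‖ContinuousLinearMap.adjoint P‖ ≤ 1 := by
    rw [LinearIsometryEquiv.norm_map]
    exact P.opNorm_le_bound zero_le_one fun x => by simpa using hP x
  have h2 : ‖ContinuousLinearMap.adjoint P (P u)‖ ≤ ‖P u‖ := by
    simpa using (ContinuousLinearMap.adjoint P).le_of_opNorm_le h1 (P u)
  have h3 : ‖ContinuousLinearMap.adjoint P (P u)‖ ^ 2 ≤ ‖P u‖ ^ 2 := by gcongr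
  rw [norm_sub_sq (𝕜 := ℂ), ContinuousLinearMap.adjoint_inner_right, inner_self_eq_norm_sq]
  linarith

lemma norm_sub_adjoint_apply_le_of_norm_eq {E F : Type*} [NormedAddCommGroup E]
    [InnerProductSpace ℂ E] [CompleteSpace E] [NormedAddCommGroup F] [InnerProductSpace ℂ F]
    [CompleteSpace F] {P : E →L[ℂ] F} (hP : ∀ u, ‖P u‖ ≤ ‖u‖) {u w : E}
    (h : ‖P (u - w)‖ = ‖u - w‖) :
    ‖u - ContinuousLinearMap.adjoint P (P u)‖ ≤ ‖w‖ := by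
  have h1 := norm_sub_adjoint_apply_sq_le hP (u - w)
  rw [h, sub_self] at h1
  have h2 := norm_eq_zero.1 (pow_eq_zero_iff two_ne_zero |>.1 (le_antisymm h1 (by positivity)))
  have h3 : u - ContinuousLinearMap.adjoint P (P u) =
      w - ContinuousLinearMap.adjoint P (P w) := by
    rw [map_sub, map_sub] at h2
    rw [← sub_eq_zero, ← h2]
    abel
  rw [h3]
  refine (sq_le_sq₀ (norm_nonneg _) (norm_nonneg _)).1 ?_
  exact (norm_sub_adjoint_apply_sq_le hP w).trans (sub_le_self _ (by positivity))

section Resolvent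

variable {d : ℕ}

/-- An `L²` function which is the inverse Fourier integral of an `L¹ ∩ L²` function `G` has
`L²` Fourier transform `G`. -/
lemma fourier_eq_of_ae_eq_integral {G : Euc d → ℂ} (hi : Integrable G) (hG : MemLp G 2) {u : L2 d}
    (hu : u =ᵐ[volume] fun x => ∫ ξ, exp (2 * π * I * (⟪x, ξ⟫_ℝ : ℂ)) * G ξ) :
    (𝓕 u : L2 d) = hG.toLp G := by
  have hinv : (fun x => ∫ ξ, exp (2 * π * I * (⟪x, ξ⟫_ℝ : ℂ)) * G ξ) = 𝓕⁻ G := by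
    funext x
    rw [Real.fourierInv_eq']
    refine integral_congr_ae (.of_forall fun ξ => ?_)
    simp only [smul_eq_mul]
    rw [real_inner_comm]
    push_cast
    ring_nf
  rw [hinv] at hu
  suffices h : u = 𝓕⁻ (hG.toLp G) by rw [h, FourierTransform.fourier_fourierInv_eq]
  refine DenseRange.eq_of_inner_right ℂ
    (SchwartzMap.denseRange_toLpCLM (F := ℂ) (μ := (volume : Measure (Euc d)))
      ENNReal.ofNat_ne_top) fun ψ => ?_
  rw [← Lp.inner_fourier_eq _ (𝓕⁻ _), FourierTransform.fourier_fourierInv_eq,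
    SchwartzMap.toLpCLM_apply, SchwartzMap.toLp_fourier_eq, L2.inner_def, L2.inner_def]
  have key : ∫ ξ, innerSL ℂ (𝓕 ψ ξ) (G ξ) = ∫ x, innerSL ℂ (ψ x) (𝓕⁻ G x) := by
    simpa [SchwartzMap.fourier_coe] using!
      VectorFourier.integral_sesq_fourierIntegral_eq_neg_flip (innerSL ℂ)
        (L := innerₗ (Euc d)) continuous_fourierChar continuous_inner ψ.integrable hi
  simp only [innerSL_apply_apply] at key
  calc _ = ∫ x, ⟪ψ x, 𝓕⁻ G x⟫_ℂ := integral_congr_ae <| by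
        filter_upwards [ψ.coeFn_toLp 2, hu] with x h1 h2
        rw [h1, h2]
    _ = ∫ ξ, ⟪𝓕 ψ ξ, G ξ⟫_ℂ := key.symm
    _ = _ := integral_congr_ae <| by
        filter_upwards [(𝓕 ψ).coeFn_toLp 2, hG.coeFn_toLp] with x h1 h2
        rw [h1, h2]

lemma exists_pos_le_norm_sub {μ : ℂ} (hμ : ∀ r : ℝ, 0 ≤ r → μ ≠ (r : ℂ)) :
    ∃ c > 0, ∀ r : ℝ, 0 ≤ r → c ≤ ‖(r : ℂ) - μ‖ := by
  have hcl : IsClosed ((fun r : ℝ => (r : ℂ)) '' Set.Ici 0) :=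
    Complex.isometry_ofReal.isClosedEmbedding.isClosedMap _ isClosed_Ici
  have hne : ((fun r : ℝ => (r : ℂ)) '' Set.Ici 0).Nonempty := ⟨_, 0, by simp, rfl⟩
  refine ⟨_, (hcl.notMem_iff_infDist_pos (x := μ) hne).1 ?_, fun r hr => ?_⟩
  · rintro ⟨r, hr, h⟩
    exact hμ r hr h.symm
  · rw [← dist_eq_norm, dist_comm]
    exact Metric.infDist_le_dist_of_mem ⟨r, hr, rfl⟩

lemma mul_norm_inv_sub_le {μ : ℂ} {c r : ℝ} (hc : 0 < c) (hr : c ≤ ‖(r : ℂ) - μ‖) :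
    r * ‖((r : ℂ) - μ)⁻¹‖ ≤ 1 + ‖μ‖ / c := by
  have hpos := hc.trans_le hr
  have h1 : r ≤ ‖(r : ℂ) - μ‖ + ‖μ‖ := by
    calc r ≤ ‖(r : ℂ)‖ := by rw [Complex.norm_real]; exact le_abs_self r
      _ = ‖((r : ℂ) - μ) + μ‖ := by rw [sub_add_cancel]
      _ ≤ _ := norm_add_le _ _
  rw [norm_inv, ← div_eq_mul_inv, div_le_iff₀ hpos, add_mul, one_mul]
  refine h1.trans (add_le_add_right ?_ _)
  rw [div_mul_eq_mul_div, le_div_iff₀ hc]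
  gcongr

/-- The Fourier transform of the free resolvent applied to a Schwartz function. -/
lemma fourier_resolvent {μ : ℂ} (hμ : ∀ r : ℝ, 0 ≤ r → μ ≠ (r : ℂ)) (f : SchwartzMap (Euc d) ℂ)
    {u : L2 d} (hu : u =ᵐ[volume] fun x => ∫ ξ, exp (2 * π * I * (⟪x, ξ⟫_ℝ : ℂ)) *
      (((‖(2 * π) • ξ‖ ^ 2 : ℝ) : ℂ) - μ)⁻¹ * 𝓕 ⇑f ξ) :
    (𝓕 u : L2 d) =ᵐ[volume]
      fun ξ => (((‖(2 * π) • ξ‖ ^ 2 : ℝ) : ℂ) - μ)⁻¹ * 𝓕 ⇑f ξ := by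
  obtain ⟨c, hc, hle⟩ := exists_pos_le_norm_sub hμ
  have hm : Continuous fun ξ : Euc d => (((‖(2 * π) • ξ‖ ^ 2 : ℝ) : ℂ) - μ)⁻¹ := by
    refine Continuous.inv₀ (by fun_prop) fun ξ => ?_
    exact sub_ne_zero.2 (hμ _ (by positivity)).symm
  have hb : ∀ ξ : Euc d, ‖(((‖(2 * π) • ξ‖ ^ 2 : ℝ) : ℂ) - μ)⁻¹‖ ≤ c⁻¹ := fun ξ => by
    rw [norm_inv]
    exact inv_anti₀ hc (hle _ (by positivity))
  have hi : Integrable (𝓕 ⇑f) := by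
    rw [← SchwartzMap.fourier_coe]
    exact (𝓕 f).integrable
  have h2 : MemLp (𝓕 ⇑f) 2 := by
    rw [← SchwartzMap.fourier_coe]
    exact (𝓕 f).memLp 2
  have hGi : Integrable fun ξ => (((‖(2 * π) • ξ‖ ^ 2 : ℝ) : ℂ) - μ)⁻¹ * 𝓕 ⇑f ξ :=
    hi.bdd_mul hm.aestronglyMeasurable (.of_forall hb)
  have hG2 : MemLp (fun ξ => (((‖(2 * π) • ξ‖ ^ 2 : ℝ) : ℂ) - μ)⁻¹ * 𝓕 ⇑f ξ) 2 := by
    refine h2.of_le_mul (c := c⁻¹) (hm.aestronglyMeasurable.mul h2.1) (.of_forall fun ξ => ?_)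
    rw [norm_mul]
    gcongr
    exact hb ξ
  simp only [mul_assoc] at hu hGi hG2
  rw [fourier_eq_of_ae_eq_integral hGi hG2 (by simpa only [mul_assoc] using hu)]
  exact hG2.coeFn_toLp

end Resolvent

lemma norm_sub_adjoint_projOp_le {d : ℕ} {h : ℝ} (hh : 0 < h) {φ : SchwartzMap (Euc d) ℂ}
    (hφ1 : ∀ ξ : Euc d, ∑' n : Zd d, ‖𝓕 ⇑φ (ξ + latVec d n)‖ ^ 2 = 1)
    (hφ2 : tsupport (𝓕 ⇑φ) ⊆ {ξ : Euc d | ∀ j, ξ j ∈ Set.Ioo (-1 : ℝ) 1})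
    {δ : ℝ} (hδ : δ ≤ 1 / 2) (hφ : ∀ ξ : Euc d, ‖ξ‖ < δ → ‖𝓕 ⇑φ ξ‖ = 1)
    {Ph : L2 d →L[ℂ] l2h d h} (hP : IsProjOp d h φ Ph) {u g : L2 d} {ε : ℝ}
    (hε : 0 ≤ ε)
    (hu : ∀ᵐ ξ, δ ≤ ‖h • ξ‖ → ‖(𝓕 u : L2 d) ξ‖ ≤ ε * ‖g ξ‖) :
    ‖u - ContinuousLinearMap.adjoint Ph (Ph u)‖ ≤ ε * ‖g‖ := by
  have hS : MeasurableSet {ξ : Euc d | δ ≤ ‖h • ξ‖} :=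
    measurableSet_le measurable_const (by fun_prop)
  have hhigh := (Lp.memLp (𝓕 u : L2 d)).indicator hS
  let v : L2 d := hhigh.toLp
  have hvae : v =ᵐ[volume] _ := hhigh.coeFn_toLp
  have hcontr := norm_projOp_le hh hφ1 hφ2 hP
  have hlow : ‖Ph (u - 𝓕⁻ v)‖ = ‖u - 𝓕⁻ v‖ := by
    refine norm_projOp_eq hh hφ1 hδ hφ hP ?_
    have hsub : 𝓕 (u - 𝓕⁻ v) = 𝓕 u - v := by
      rw [sub_eq_add_neg, FourierTransform.fourier_add, FourierTransform.fourier_neg,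
        FourierTransform.fourier_fourierInv_eq, ← sub_eq_add_neg]
    rw [hsub]
    filter_upwards [Lp.coeFn_sub (𝓕 u) v, hvae] with ξ h1 h2 hξ
    rw [h1, Pi.sub_apply, h2, Set.indicator_of_mem (by exact hξ), sub_self]
  refine (norm_sub_adjoint_apply_le_of_norm_eq hcontr hlow).trans ?_
  have hn : ‖(𝓕⁻ v : L2 d)‖ = ‖v‖ := by
    rw [← Lp.norm_fourier_eq, FourierTransform.fourier_fourierInv_eq]
  rw [hn]
  refine Lp.norm_le_mul_norm_of_ae_le_mul ?_
  filter_upwards [hvae, hu] with ξ h5 h6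
  rw [h5]
  by_cases hξ : δ ≤ ‖h • ξ‖
  · rw [Set.indicator_of_mem (by exact hξ)]
    exact h6 hξ
  · rw [Set.indicator_of_notMem (by exact hξ), norm_zero]
    positivity

/-- Suppose `φ` satisfies Assumption (φ).  For every `μ ∈ ℂ \ [0,∞)` there
is `C > 0` such that `‖(1 − P_h* P_h)(H₀ − μ)⁻¹‖_{B(L²(ℝ^d))} ≤ C h²` for all `h > 0`, where
`(H₀ − μ)⁻¹` is the Fourier multiplier with symbol `ξ ↦ (|2πξ|² − μ)⁻¹`. -/
theorem one_sub_projection_free_resolvent_bound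
    (d : ℕ) (φ : SchwartzMap (Euc d) ℂ)
    (hφ1 : ∀ ξ : Euc d, ∑' n : Zd d, ‖𝓕 ⇑φ (ξ + latVec d n)‖ ^ 2 = 1)
    (hφ2 : tsupport (𝓕 ⇑φ) ⊆ {ξ : Euc d | ∀ j, ξ j ∈ Set.Ioo (-1 : ℝ) 1})
    (μ : ℂ) (hμ : ∀ r : ℝ, 0 ≤ r → μ ≠ (r : ℂ))
    (R0 : L2 d →L[ℂ] L2 d)
    (hR0 : ∀ (f : SchwartzMap (Euc d) ℂ) (hf : MemLp ⇑f 2 (volume : Measure (Euc d))),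
      (R0 (hf.toLp ⇑f) : Euc d → ℂ) =ᵐ[volume]
        fun x => ∫ ξ, Complex.exp (2 * π * Complex.I * (⟪x, ξ⟫_ℝ : ℂ)) *
          (((‖(2 * π) • ξ‖ ^ 2 : ℝ) : ℂ) - μ)⁻¹ * 𝓕 ⇑f ξ) :
    ∃ C > (0 : ℝ), ∀ h : ℝ, 0 < h →
      ∀ Ph : L2 d →L[ℂ] l2h d h, IsProjOp d h φ Ph →
        ‖(ContinuousLinearMap.id ℂ (L2 d) -
            (ContinuousLinearMap.adjoint Ph).comp Ph).comp R0‖ ≤ C * h ^ 2 := by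
  obtain ⟨δ, hδ, hδ2, hφ⟩ := exists_norm_eq_one hφ1 hφ2
  obtain ⟨c, hc, hle⟩ := exists_pos_le_norm_sub hμ
  refine ⟨(1 + ‖μ‖ / c) / δ ^ 2, by positivity, fun h hh Ph hP => ?_⟩
  refine ContinuousLinearMap.opNorm_le_bound _ (by positivity) fun f => ?_
  refine DenseRange.induction_on (SchwartzMap.denseRange_toLpCLM (F := ℂ)
    (p := 2) (μ := (volume : Measure (Euc d))) ENNReal.ofNat_ne_top) f
    (isClosed_le (by fun_prop) (by fun_prop)) fun f => ?_
  have hn : ‖f.toLp 2‖ = ‖(𝓕 f).toLp 2‖ := by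
    rw [← SchwartzMap.toLp_fourier_eq]
    exact (Lp.norm_fourier_eq _).symm
  rw [SchwartzMap.toLpCLM_apply, hn]
  refine norm_sub_adjoint_projOp_le hh hφ1 hφ2 hδ2 hφ hP (by positivity) ?_
  filter_upwards [fourier_resolvent hμ f (hR0 f (f.memLp 2)), (𝓕 f).coeFn_toLp 2]
    with ξ h1 h2 hξ
  rw [h2, SchwartzMap.fourier_coe]
  refine (congrArg norm h1).trans_le ?_
  rw [norm_mul]
  gcongr
  have h3 := mul_norm_inv_sub_le hc (hle (‖(2 * π) • ξ‖ ^ 2) (by positivity))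
  set m := ‖(((‖(2 * π) • ξ‖ ^ 2 : ℝ) : ℂ) - μ)⁻¹‖ with hm
  have h4 : δ ^ 2 ≤ h ^ 2 * ‖(2 * π) • ξ‖ ^ 2 := by
    rw [← mul_pow]
    refine pow_le_pow_left₀ hδ.le (hξ.trans ?_) 2
    rw [norm_smul, norm_smul, Real.norm_of_nonneg hh.le, Real.norm_of_nonneg (by positivity)]
    gcongr
    exact le_mul_of_one_le_left (norm_nonneg _) (by linarith [Real.two_le_pi])
  rw [div_mul_eq_mul_div, le_div_iff₀ (by positivity)]
  calc m * δ ^ 2 ≤ m * (h ^ 2 * ‖(2 * π) • ξ‖ ^ 2) := by gcongr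
    _ = (‖(2 * π) • ξ‖ ^ 2 * m) * h ^ 2 := by ring
    _ ≤ _ := by gcongr
end
end

section
/- Suppose φ ∈ 𝒮(ℝ^d) satisfies Assumption (φ). For every μ ∈ ℂ \ [0,∞) there is C > 0 such that for all h > 0, ‖(H_{0,h} − μ)⁻¹ P_h − P_h (H₀ − μ)⁻¹‖_{B(L²(ℝ^d), ℓ²(hℤ^d))} ≤ C h², where (H₀ − μ)⁻¹ is the Fourier multiplier on L²(ℝ^d) with symbol ξ ↦ (|2πξ|² − μ)⁻¹ and (H_{0,h} − μ)⁻¹ = F_h* M_{(H_{0,h}(·)−μ)⁻¹} F_h with H_{0,h}(ζ) = 2h^{−2} ∑_{j=1}^d (1 − cos(2π h ζ_j)). -/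
open MeasureTheory Complex Real
open scoped FourierTransform InnerProductSpace ENNReal ComplexConjugate

noncomputable section

/-- The free discrete Schrödinger operator `H_{0,h}` on `ℓ²(hℤ^d)`:
`(H_{0,h} v)(hz) = h⁻² ∑_j (2v(hz) − v(hz+he_j) − v(hz−he_j))`.  (It is a bounded operator
for fixed `h > 0`, and `H_{0,h} = F_h* M_{H_{0,h}(·)} F_h` with symbol
`H_{0,h}(ζ) = 2h⁻² ∑_j (1 − cos(2π h ζ_j))`.) -/
def IsDiscreteFree (d : ℕ) (h : ℝ) (H0h : l2h d h →L[ℂ] l2h d h) : Prop :=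
  ∀ v : l2h d h, ∀ z : Zd d,
    (H0h v : Zd d → ℂ) z =
      (h ^ 2 : ℂ)⁻¹ * ∑ j : Fin d,
        (2 * (v : Zd d → ℂ) z - (v : Zd d → ℂ) (z + Pi.single j 1)
          - (v : Zd d → ℂ) (z - Pi.single j 1))

lemma setIntegral_unitCube_exp (d : ℕ) (k : Zd d) :
    ∫ x in Set.univ.pi (fun _ : Fin d => Set.Ico (0 : ℝ) 1),
      Complex.exp (2 * π * I * ∑ j, (k j : ℂ) * (x j : ℂ)) = if k = 0 then 1 else 0 := by
  have h1 : ∀ x : Fin d → ℝ, Complex.exp (2 * π * I * ∑ j, (k j : ℂ) * (x j : ℂ))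
      = ∏ j, Complex.exp (2 * π * I * (k j : ℂ) * (x j : ℂ)) := by
    intro x
    rw [← Complex.exp_sum, Finset.mul_sum]
    simp only [mul_assoc]
  simp only [h1]
  rw [volume_pi, Measure.restrict_pi_pi,
    integral_fintype_prod_eq_prod (𝕜 := ℂ)
      (f := fun (j : Fin d) (t : ℝ) => Complex.exp (2 * π * I * (k j : ℂ) * (t : ℂ)))]
  have h2 : ∀ m : ℤ, ∫ t in Set.Ico (0 : ℝ) 1, Complex.exp (2 * π * I * (m : ℂ) * (t : ℂ))
      = if m = 0 then 1 else 0 := by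
    intro m
    rw [integral_Ico_eq_integral_Ioc, ← intervalIntegral.integral_of_le zero_le_one]
    split_ifs with hm
    · simp [hm]
    · have hc : (2 * π * I * (m : ℂ)) ≠ 0 := by
        simp [hm, Real.pi_ne_zero]
      rw [integral_exp_mul_complex hc]
      have : Complex.exp (2 * π * I * (m : ℂ) * ((1 : ℝ) : ℂ)) = 1 := by
        rw [Complex.exp_eq_one_iff]
        exact ⟨m, by push_cast; ring⟩
      rw [this]
      simp
  simp only [h2]
  split_ifs with hk
  · simp [hk]
  · obtain ⟨j, hj⟩ := Function.ne_iff.mp hk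
    exact Finset.prod_eq_zero (Finset.mem_univ j) (by simpa using hj)

lemma pairwise_disjoint_unitCube_translates (d : ℕ) :
    Pairwise (Function.onFun Disjoint fun n : Zd d =>
      Set.univ.pi fun j => Set.Ico (n j : ℝ) (n j + 1)) := by
  intro m n hmn
  obtain ⟨j, hj⟩ := Function.ne_iff.mp hmn
  refine Set.disjoint_left.mpr fun x hx hy => hj ?_
  have h1 := hx j (Set.mem_univ j)
  have h2 := hy j (Set.mem_univ j)
  rw [← Int.floor_eq_iff.mpr h1, ← Int.floor_eq_iff.mpr h2]

lemma iUnion_unitCube_translates (d : ℕ) :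
    ⋃ n : Zd d, (Set.univ.pi fun j => Set.Ico (n j : ℝ) (n j + 1)) = Set.univ := by
  refine Set.eq_univ_of_forall fun x => Set.mem_iUnion.mpr ⟨fun j => ⌊x j⌋, fun j _ => ?_⟩
  exact ⟨Int.floor_le _, Int.lt_floor_add_one _⟩

lemma setIntegral_unitCube_translate {E : Type*} [NormedAddCommGroup E] [NormedSpace ℝ E]
    (d : ℕ) (f : (Fin d → ℝ) → E) (n : Zd d) :
    ∫ x in Set.univ.pi (fun j => Set.Ico (n j : ℝ) (n j + 1)), f x =
      ∫ x in Set.univ.pi (fun _ : Fin d => Set.Ico (0 : ℝ) 1), f (x + fun j => (n j : ℝ)) := by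
  have hmp := measurePreserving_add_right (volume : Measure (Fin d → ℝ)) (fun j => (n j : ℝ))
  rw [← hmp.setIntegral_preimage_emb (measurableEmbedding_addRight _)]
  congr 2
  ext x
  simp only [Set.mem_preimage, Set.mem_pi, Set.mem_univ, true_implies, Set.mem_Ico, Pi.add_apply]
  refine forall_congr' fun j => ?_
  constructor <;> rintro ⟨h1, h2⟩ <;> constructor <;> linarith

lemma integral_eq_setIntegral_unitCube_tsum (d : ℕ) {f : (Fin d → ℝ) → ℂ} (hf : Integrable f) :
    ∫ x, f x = ∫ x in Set.univ.pi (fun _ : Fin d => Set.Ico (0 : ℝ) 1),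
      ∑' n : Zd d, f (x + fun j => (n j : ℝ)) := by
  have hmeas : ∀ n : Zd d, MeasurableSet
      (Set.univ.pi fun j => Set.Ico (n j : ℝ) (n j + 1)) := fun n =>
    MeasurableSet.univ_pi fun j => measurableSet_Ico
  have key : ∀ {E : Type} [NormedAddCommGroup E] [NormedSpace ℝ E] (g : (Fin d → ℝ) → E),
      Integrable g → HasSum (fun n : Zd d =>
        ∫ x in Set.univ.pi (fun _ : Fin d => Set.Ico (0 : ℝ) 1), g (x + fun j => (n j : ℝ)))
        (∫ x, g x) := by
    intro E _ _ g hg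
    have := hasSum_integral_iUnion hmeas (pairwise_disjoint_unitCube_translates d)
      (f := g) (μ := volume) hg.integrableOn
    rw [iUnion_unitCube_translates, setIntegral_univ] at this
    simpa only [setIntegral_unitCube_translate] using this
  rw [← integral_tsum_of_summable_integral_norm, (key f hf).tsum_eq]
  · exact fun n => (hf.comp_add_right _).integrableOn
  · exact (key _ hf.norm).summable

/-- The character `ξ ↦ exp(2πi hz·ξ)` attached to the lattice point `hz`. -/
def latChar (d : ℕ) (h : ℝ) (z : Zd d) (ξ : Euc d) : ℂ :=
  Complex.exp (2 * π * I * (⟪latPt d h z, ξ⟫_ℝ : ℂ))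

lemma inner_latPt (d : ℕ) (h : ℝ) (z : Zd d) (ξ : Euc d) :
    ⟪latPt d h z, ξ⟫_ℝ = ∑ j, (z j : ℝ) * (h * ξ j) := by
  simp only [PiLp.inner_apply, latPt]
  refine Finset.sum_congr rfl fun j _ => ?_
  simp
  ring

lemma latChar_eq (d : ℕ) (h : ℝ) (z : Zd d) (ξ : Euc d) :
    latChar d h z ξ = Complex.exp (2 * π * I * ∑ j, (z j : ℂ) * (h * ξ j : ℝ)) := by
  rw [latChar, inner_latPt]
  push_cast
  rfl

lemma latChar_smul (d : ℕ) (h : ℝ) (z : Zd d) (ξ : Euc d) :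
    latChar d 1 z (h • ξ) = latChar d h z ξ := by
  simp [latChar_eq]

lemma latChar_add (d : ℕ) (h : ℝ) (y z : Zd d) (ξ : Euc d) :
    latChar d h (y + z) ξ = latChar d h y ξ * latChar d h z ξ := by
  simp only [latChar_eq, ← Complex.exp_add, ← mul_add, ← Finset.sum_add_distrib]
  congr 2
  refine Finset.sum_congr rfl fun j _ => ?_
  simp
  ring

lemma latChar_neg (d : ℕ) (h : ℝ) (z : Zd d) (ξ : Euc d) :
    latChar d h (-z) ξ = conj (latChar d h z ξ) := by
  simp only [latChar_eq, ← Complex.exp_conj]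
  congr 1
  simp [Complex.conj_ofNat]

lemma norm_latChar (d : ℕ) (h : ℝ) (z : Zd d) (ξ : Euc d) : ‖latChar d h z ξ‖ = 1 := by
  rw [latChar, show (2 * π * I * (⟪latPt d h z, ξ⟫_ℝ : ℂ)) =
    ((2 * π * ⟪latPt d h z, ξ⟫_ℝ : ℝ) : ℂ) * I by push_cast; ring]
  exact Complex.norm_exp_ofReal_mul_I _

lemma continuous_latChar (d : ℕ) (h : ℝ) (z : Zd d) : Continuous (latChar d h z) := by
  unfold latChar
  fun_prop

lemma integral_latChar_mul_norm_sq (d : ℕ) {Φ : Euc d → ℂ} (hΦ : MemLp Φ 2 volume)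
    (hsum : ∀ ξ : Euc d, ∑' n : Zd d, ‖Φ (ξ + latVec d n)‖ ^ 2 = 1) (k : Zd d) :
    ∫ ξ, latChar d 1 k ξ * (‖Φ ξ‖ ^ 2 : ℝ) = if k = 0 then 1 else 0 := by
  have hint : Integrable fun ξ => latChar d 1 k ξ * ((‖Φ ξ‖ ^ 2 : ℝ) : ℂ) := by
    refine ((memLp_two_iff_integrable_sq_norm hΦ.1).mp hΦ).ofReal.bdd_mul (c := 1)
      (continuous_latChar d 1 k).aestronglyMeasurable (.of_forall fun ξ => ?_)
    rw [norm_latChar]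
  have hmp := PiLp.volume_preserving_toLp (Fin d)
  have hme := (MeasurableEquiv.toLp 2 (Fin d → ℝ)).measurableEmbedding
  have hint' := (hmp.integrable_comp_emb hme).mpr hint
  rw [Function.comp_def] at hint'
  rw [← hmp.integral_comp hme, integral_eq_setIntegral_unitCube_tsum d hint',
    ← setIntegral_unitCube_exp]
  refine integral_congr_ae (.of_forall fun x => ?_)
  have h1 : ∀ n : Zd d, latChar d 1 k (WithLp.toLp 2 (x + fun j => (n j : ℝ))) =
      latChar d 1 k (WithLp.toLp 2 x) := by
    intro n
    simp only [latChar_eq]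
    rw [Complex.exp_eq_exp_iff_exists_int]
    refine ⟨∑ j, k j * n j, ?_⟩
    simp [mul_add, Finset.sum_add_distrib]
    ring
  have h2 : ∀ n : Zd d, (WithLp.toLp 2 (x + fun j => (n j : ℝ)) : Euc d) =
      WithLp.toLp 2 x + latVec d n := fun n => rfl
  simp only [h1, tsum_mul_left, ← Complex.ofReal_tsum]
  simp only [h2, hsum, latChar_eq]
  simp

/-- The normalized Fourier-side translates `h^{d/2} e^{-2πi hz·ξ} Φ(hξ)`. -/
def freqAtom (d : ℕ) (h : ℝ) (Φ : Euc d → ℂ) (z : Zd d) (ξ : Euc d) : ℂ :=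
  (√(h ^ d) : ℂ) * (conj (latChar d h z ξ) * Φ (h • ξ))

lemma memLp_freqAtom (d : ℕ) {h : ℝ} (hh : 0 < h) {Φ : Euc d → ℂ} (hΦc : Continuous Φ)
    (hΦ : MemLp Φ 2 volume) (z : Zd d) : MemLp (freqAtom d h Φ z) 2 volume := by
  have hc : Continuous (freqAtom d h Φ z) := by
    have := continuous_latChar d h z
    unfold freqAtom
    fun_prop
  rw [memLp_two_iff_integrable_sq_norm hc.aestronglyMeasurable]
  have := ((memLp_two_iff_integrable_sq_norm hΦ.1).mp hΦ).comp_smul hh.ne'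
  convert! this.const_mul (√(h ^ d) ^ 2) using 2 with ξ
  simp [freqAtom, norm_latChar, mul_pow]

lemma orthonormal_freqAtom (d : ℕ) {h : ℝ} (hh : 0 < h) {Φ : Euc d → ℂ} (hΦc : Continuous Φ)
    (hΦ : MemLp Φ 2 volume)
    (hsum : ∀ ξ : Euc d, ∑' n : Zd d, ‖Φ (ξ + latVec d n)‖ ^ 2 = 1) :
    Orthonormal ℂ fun z : Zd d => (memLp_freqAtom d hh hΦc hΦ z).toLp _ := by
  classical
  rw [orthonormal_iff_ite]
  intro y z
  rw [MeasureTheory.L2.inner_def]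
  have hd : (0 : ℝ) < h ^ d := pow_pos hh d
  calc _ = ∫ ξ, ((h ^ d : ℝ) : ℂ) *
          (latChar d 1 (y - z) (h • ξ) * ((‖Φ (h • ξ)‖ ^ 2 : ℝ) : ℂ)) := by
        refine integral_congr_ae ?_
        filter_upwards [(memLp_freqAtom d hh hΦc hΦ y).coeFn_toLp,
          (memLp_freqAtom d hh hΦc hΦ z).coeFn_toLp] with ξ h1 h2
        rw [h1, h2, latChar_smul, sub_eq_add_neg, latChar_add, latChar_neg,
          ← Real.mul_self_sqrt hd.le, RCLike.inner_apply, freqAtom, freqAtom]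
        have := Complex.mul_conj' (Φ (h • ξ))
        simp only [map_mul, Complex.conj_conj, Complex.conj_ofReal]
        push_cast
        rw [← this]
        ring
    _ = _ := by
        rw [integral_const_mul, Measure.integral_comp_smul volume
          (fun ξ => latChar d 1 (y - z) ξ * ((‖Φ ξ‖ ^ 2 : ℝ) : ℂ)) h,
          integral_latChar_mul_norm_sq d hΦ hsum]
        rw [finrank_euclideanSpace_fin, abs_of_pos (inv_pos.mpr hd), Complex.real_smul,
          ← mul_assoc, ← Complex.ofReal_mul, mul_inv_cancel₀ hd.ne']
        simp [sub_eq_zero]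

/-- The symbol `|2πξ|²` of `H₀ = -Δ`. -/
def freeSymbol (d : ℕ) (ξ : Euc d) : ℝ := ‖(2 * π) • ξ‖ ^ 2

/-- The symbol `2h⁻² ∑ⱼ (1 - cos(2πhξⱼ))` of `H_{0,h}`. -/
def discreteSymbol (d : ℕ) (h : ℝ) (ξ : Euc d) : ℝ :=
  2 * (h ^ 2)⁻¹ * ∑ j, (1 - Real.cos (2 * π * (h * ξ j)))

lemma freeSymbol_nonneg (d : ℕ) (ξ : Euc d) : 0 ≤ freeSymbol d ξ := sq_nonneg _

lemma discreteSymbol_nonneg (d : ℕ) (h : ℝ) (ξ : Euc d) : 0 ≤ discreteSymbol d h ξ := by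
  have : 0 ≤ ∑ j, (1 - Real.cos (2 * π * (h * ξ j))) :=
    Finset.sum_nonneg fun j _ => sub_nonneg.mpr (Real.cos_le_one _)
  unfold discreteSymbol
  positivity

lemma continuous_freeSymbol (d : ℕ) : Continuous (freeSymbol d) := by
  unfold freeSymbol
  fun_prop

lemma continuous_discreteSymbol (d : ℕ) (h : ℝ) : Continuous (discreteSymbol d h) := by
  unfold discreteSymbol
  fun_prop

lemma freeSymbol_eq (d : ℕ) (ξ : Euc d) : freeSymbol d ξ = ∑ j, (2 * π * ξ j) ^ 2 := by
  simp [freeSymbol, EuclideanSpace.norm_sq_eq, mul_pow]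

lemma exists_one_add_le_mul_norm_sub {μ : ℂ} (hμ : ∀ r : ℝ, 0 ≤ r → μ ≠ (r : ℂ)) :
    ∃ K > (0 : ℝ), ∀ r : ℝ, 0 ≤ r → 1 + r ≤ K * ‖(r : ℂ) - μ‖ := by
  have hcl : IsClosed (Complex.ofReal '' Set.Ici 0) :=
    Complex.isometry_ofReal.isClosedEmbedding.isClosedMap _ isClosed_Ici
  have hne : (Complex.ofReal '' Set.Ici 0).Nonempty := ⟨_, 0, Set.self_mem_Ici, rfl⟩
  have hδ : 0 < Metric.infDist μ (Complex.ofReal '' Set.Ici 0) := by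
    refine (hcl.notMem_iff_infDist_pos hne).mp ?_
    rintro ⟨r, hr, h⟩
    exact hμ r hr h.symm
  set δ := Metric.infDist μ (Complex.ofReal '' Set.Ici 0)
  refine ⟨(1 + ‖μ‖) / δ + 1, by positivity, fun r hr => ?_⟩
  have h1 : δ ≤ ‖(r : ℂ) - μ‖ := by
    rw [← dist_eq_norm, dist_comm]
    exact Metric.infDist_le_dist_of_mem ⟨r, hr, rfl⟩
  have h2 : r - ‖μ‖ ≤ ‖(r : ℂ) - μ‖ := by
    have := norm_sub_norm_le (r : ℂ) μ
    rwa [Complex.norm_of_nonneg hr] at this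
  have h3 : 1 + ‖μ‖ ≤ (1 + ‖μ‖) / δ * ‖(r : ℂ) - μ‖ := by
    rw [div_mul_eq_mul_div, le_div_iff₀ hδ]
    gcongr
  linarith

lemma abs_sq_sub_two_mul_one_sub_cos_le (t : ℝ) : |t ^ 2 - 2 * (1 - Real.cos t)| ≤ t ^ 4 := by
  have h1 := Real.one_sub_sq_div_two_le_cos (x := t)
  rw [abs_of_nonneg (by linarith)]
  rcases le_or_gt |t| 1 with h | h
  · have := (abs_le.mp (Real.cos_bound h)).2
    rw [Even.pow_abs (by decide)] at this
    nlinarith [sq_nonneg (t ^ 2)]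
  · have h2 := Real.cos_le_one t
    have h3 : 1 ≤ t ^ 2 := by
      rw [← sq_abs]
      nlinarith
    nlinarith

lemma le_two_mul_one_sub_cos {δ s : ℝ} (hδ0 : 0 ≤ δ) (hs : |s| ≤ 1 - δ) :
    16 * δ ^ 2 * s ^ 2 ≤ 2 * (1 - Real.cos (2 * π * s)) := by
  have hδ1 : δ ≤ 1 := by linarith [abs_nonneg s]
  have hsin : 2 * δ * |s| ≤ Real.sin (π * |s|) := by
    rcases le_total |s| (1 / 2) with h | h
    · have := Real.mul_le_sin (x := π * |s|) (by positivity) (by nlinarith [Real.pi_pos])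
      have e : 2 / π * (π * |s|) = 2 * |s| := by field_simp
      nlinarith [abs_nonneg s]
    · have := Real.mul_le_sin (x := π - π * |s|) (by nlinarith [Real.pi_pos])
        (by nlinarith [Real.pi_pos])
      have e : 2 / π * (π - π * |s|) = 2 * (1 - |s|) := by field_simp
      rw [Real.sin_pi_sub] at this
      nlinarith [abs_nonneg s]
  have hcos : Real.cos (2 * π * s) = 1 - 2 * Real.sin (π * |s|) ^ 2 := by
    rw [show 2 * π * s = 2 * (π * s) by ring, Real.cos_two_mul, Real.cos_sq']
    rcases abs_choice s with h | h <;> rw [h]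
    · ring
    · rw [mul_neg, Real.sin_neg]
      ring
  have hsq : (2 * δ * |s|) ^ 2 ≤ Real.sin (π * |s|) ^ 2 := by gcongr
  rw [mul_pow, sq_abs] at hsq
  rw [hcos]
  nlinarith

lemma abs_freeSymbol_sub_discreteSymbol_le (d : ℕ) {h : ℝ} (hh : 0 < h) (ξ : Euc d) :
    |freeSymbol d ξ - discreteSymbol d h ξ| ≤ h ^ 2 * freeSymbol d ξ ^ 2 := by
  have e : freeSymbol d ξ - discreteSymbol d h ξ = (h ^ 2)⁻¹ *
      ∑ j, ((2 * π * (h * ξ j)) ^ 2 - 2 * (1 - Real.cos (2 * π * (h * ξ j)))) := by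
    rw [freeSymbol_eq, discreteSymbol, Finset.mul_sum, Finset.mul_sum, ← Finset.sum_sub_distrib]
    refine Finset.sum_congr rfl fun j _ => ?_
    field_simp
  rw [e, abs_mul, abs_of_pos (by positivity : 0 < (h ^ 2)⁻¹)]
  calc _ ≤ (h ^ 2)⁻¹ * ∑ j, (2 * π * (h * ξ j)) ^ 4 := by
        gcongr
        exact (Finset.abs_sum_le_sum_abs _ _).trans
          (Finset.sum_le_sum fun j _ => abs_sq_sub_two_mul_one_sub_cos_le _)
    _ = h ^ 2 * ∑ j, ((2 * π * ξ j) ^ 2) ^ 2 := by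
        rw [Finset.mul_sum, Finset.mul_sum]
        refine Finset.sum_congr rfl fun j _ => ?_
        field_simp
    _ ≤ h ^ 2 * freeSymbol d ξ ^ 2 := by
        rw [freeSymbol_eq]
        gcongr
        exact Finset.sum_sq_le_sq_sum_of_nonneg fun j _ => sq_nonneg _

lemma mul_freeSymbol_le_discreteSymbol (d : ℕ) {h δ : ℝ} (hh : 0 < h) (hδ : 0 ≤ δ) (ξ : Euc d)
    (hξ : ∀ j, |h * ξ j| ≤ 1 - δ) :
    4 * δ ^ 2 / π ^ 2 * freeSymbol d ξ ≤ discreteSymbol d h ξ := by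
  rw [freeSymbol_eq, discreteSymbol, mul_assoc, mul_left_comm, Finset.mul_sum, Finset.mul_sum,
    Finset.mul_sum]
  refine Finset.sum_le_sum fun j _ => ?_
  have := le_two_mul_one_sub_cos hδ (hξ j)
  rw [inv_mul_eq_div, le_div_iff₀ (by positivity)]
  refine le_of_eq_of_le ?_ this
  field_simp
  ring

lemma exists_norm_resolventSymbol_sub_le (d : ℕ) {μ : ℂ} (hμ : ∀ r : ℝ, 0 ≤ r → μ ≠ (r : ℂ))
    {δ : ℝ} (hδ : 0 < δ) :
    ∃ C > (0 : ℝ), ∀ h : ℝ, 0 < h → ∀ ξ : Euc d, (∀ j, |h * ξ j| ≤ 1 - δ) →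
      ‖((discreteSymbol d h ξ : ℂ) - μ)⁻¹ - ((freeSymbol d ξ : ℂ) - μ)⁻¹‖ ≤ C * h ^ 2 := by
  obtain ⟨K, hK, hKr⟩ := exists_one_add_le_mul_norm_sub hμ
  set c : ℝ := 4 * δ ^ 2 / π ^ 2 with hc
  have hc0 : 0 < c := by positivity
  refine ⟨K ^ 2 / c, by positivity, fun h hh ξ hξ => ?_⟩
  have ha0 := discreteSymbol_nonneg d h ξ
  have hb0 := freeSymbol_nonneg d ξ
  have hab := mul_freeSymbol_le_discreteSymbol d hh hδ.le ξ hξ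
  have hdiff := abs_freeSymbol_sub_discreteSymbol_le d hh ξ
  rw [← hc] at hab
  set a := discreteSymbol d h ξ
  set b := freeSymbol d ξ
  have hane : (a : ℂ) - μ ≠ 0 := sub_ne_zero.mpr (hμ a ha0).symm
  have hbne : (b : ℂ) - μ ≠ 0 := sub_ne_zero.mpr (hμ b hb0).symm
  have e : ((a : ℂ) - μ)⁻¹ - ((b : ℂ) - μ)⁻¹ =
      ((b - a : ℝ) : ℂ) / (((a : ℂ) - μ) * ((b : ℂ) - μ)) := by
    rw [inv_sub_inv hane hbne]
    congr 1
    push_cast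
    ring
  have hA := norm_pos_iff.mpr hane
  have hB := norm_pos_iff.mpr hbne
  rw [e, norm_div, norm_mul, Complex.norm_real, Real.norm_eq_abs, div_le_iff₀ (by positivity)]
  have h1 : c * b ^ 2 ≤ K ^ 2 * (‖(a : ℂ) - μ‖ * ‖(b : ℂ) - μ‖) := by
    calc c * b ^ 2 = (c * b) * b := by ring
      _ ≤ (K * ‖(a : ℂ) - μ‖) * (K * ‖(b : ℂ) - μ‖) :=
        mul_le_mul (by linarith [hKr a ha0]) (by linarith [hKr b hb0]) hb0 (by positivity)
      _ = _ := by ring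
  calc |b - a| ≤ h ^ 2 * b ^ 2 := hdiff
    _ = h ^ 2 * (c * b ^ 2 / c) := by field_simp
    _ ≤ h ^ 2 * (K ^ 2 * (‖(a : ℂ) - μ‖ * ‖(b : ℂ) - μ‖) / c) := by gcongr
    _ = _ := by ring

lemma exists_forall_abs_le_of_tsupport_subset {d : ℕ} {Φ : Euc d → ℂ}
    (hΦ : tsupport Φ ⊆ {ξ : Euc d | ∀ j, ξ j ∈ Set.Ioo (-1 : ℝ) 1}) :
    ∃ δ > (0 : ℝ), ∀ ξ, Φ ξ ≠ 0 → ∀ j, |ξ j| ≤ 1 - δ := by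
  have hcpt : IsCompact (WithLp.ofLp '' tsupport Φ : Set (Fin d → ℝ)) := by
    have hcl : IsClosed (WithLp.ofLp '' tsupport Φ : Set (Fin d → ℝ)) :=
      (PiLp.homeomorph 2 (fun _ : Fin d => ℝ)).isClosedMap _ (isClosed_tsupport Φ)
    refine (isCompact_univ_pi fun _ : Fin d =>
      isCompact_Icc (a := (-1 : ℝ)) (b := 1)).of_isClosed_subset hcl ?_
    rintro _ ⟨ξ, hξ, rfl⟩ j -
    exact Set.Ioo_subset_Icc_self (hΦ hξ j)
  rcases Set.eq_empty_or_nonempty (WithLp.ofLp '' tsupport Φ : Set (Fin d → ℝ)) with he | hne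
  · refine ⟨1, one_pos, fun ξ hξ => ?_⟩
    have : ξ ∈ tsupport Φ := subset_tsupport Φ hξ
    rw [Set.image_eq_empty] at he
    simp [he] at this
  · obtain ⟨x, ⟨ξ₀, hξ₀, rfl⟩, hmax⟩ := hcpt.exists_isMaxOn hne continuous_norm.continuousOn
    have hlt : ‖ξ₀.ofLp‖ < 1 := by
      rw [pi_norm_lt_iff one_pos]
      exact fun j => abs_lt.mpr (hΦ hξ₀ j)
    refine ⟨1 - ‖ξ₀.ofLp‖, by linarith, fun ξ hξ j => ?_⟩
    have h1 : ‖ξ.ofLp‖ ≤ ‖ξ₀.ofLp‖ := hmax ⟨ξ, subset_tsupport Φ hξ, rfl⟩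
    have h2 := norm_le_pi_norm ξ.ofLp j
    rw [Real.norm_eq_abs] at h2
    linarith

lemma L2_norm_sq_eq_integral {α : Type*} {m : MeasurableSpace α} {ν : Measure α} (f : Lp ℂ 2 ν) :
    ‖f‖ ^ 2 = ∫ a, ‖f a‖ ^ 2 ∂ν := by
  have h := MeasureTheory.L2.inner_def (𝕜 := ℂ) f f
  simp only [inner_self_eq_norm_sq_to_K] at h
  apply Complex.ofReal_injective
  rw [← integral_complex_ofReal]
  push_cast
  exact h

lemma latMeas_singleton (d : ℕ) (h : ℝ) (z : Zd d) :
    latMeas d h {z} = ENNReal.ofReal (h ^ d) := by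
  simp [latMeas]

lemma ae_latMeas_iff (d : ℕ) {h : ℝ} (hh : 0 < h) {p : Zd d → Prop} :
    (∀ᵐ z ∂latMeas d h, p z) ↔ ∀ z, p z := by
  rw [ae_iff_of_countable]
  refine forall_congr' fun z => ?_
  rw [latMeas_singleton]
  simp [pow_pos hh d]

lemma memLp_latMeas (d : ℕ) {h : ℝ} {a : Zd d → ℂ}
    (ha : Summable fun z => ‖a z‖ ^ 2) : MemLp a 2 (latMeas d h) := by
  rw [memLp_two_iff_integrable_sq_norm Measurable.of_discrete.aestronglyMeasurable]
  refine Integrable.smul_measure ?_ ENNReal.ofReal_ne_top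
  rw [integrable_count_iff]
  simpa using ha

lemma l2h_norm_sq (d : ℕ) {h : ℝ} (hh : 0 < h) (v : l2h d h) :
    ‖v‖ ^ 2 = h ^ d * ∑' z, ‖(v : Zd d → ℂ) z‖ ^ 2 := by
  have hi : Integrable (fun z => ‖(v : Zd d → ℂ) z‖ ^ 2) (latMeas d h) :=
    (memLp_two_iff_integrable_sq_norm (Lp.memLp v).1).mp (Lp.memLp v)
  rw [L2_norm_sq_eq_integral, integral_countable hi, ← tsum_mul_left]
  refine tsum_congr fun z => ?_
  rw [measureReal_def, latMeas_singleton, ENNReal.toReal_ofReal (pow_pos hh d).le, smul_eq_mul]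

lemma eq_of_isDiscreteFree_resolvent (d : ℕ) {h : ℝ} {μ : ℂ}
    {H0h : l2h d h →L[ℂ] l2h d h} (hH : IsDiscreteFree d h H0h) {w v : l2h d h}
    (hwv : ∀ z : Zd d, (h ^ 2 : ℂ)⁻¹ * ∑ j : Fin d, (2 * (w : Zd d → ℂ) z
      - (w : Zd d → ℂ) (z + Pi.single j 1) - (w : Zd d → ℂ) (z - Pi.single j 1))
      - μ * (w : Zd d → ℂ) z = (v : Zd d → ℂ) z) :
    H0h w - μ • w = v := by
  refine Lp.ext ?_
  filter_upwards [Lp.coeFn_sub (H0h w) (μ • w), Lp.coeFn_smul μ w] with z h1 h2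
  rw [h1, Pi.sub_apply, h2, Pi.smul_apply, hH w z, smul_eq_mul, hwv z]

/-- The lattice coefficients `∫ e^{2πi hz·ξ} conj(Φ(hξ)) g(ξ) dξ`; for `Φ = φ̂` and `g = û` these
are the values of `P_h u`. -/
def projCoeff (d : ℕ) (h : ℝ) (Φ g : Euc d → ℂ) (z : Zd d) : ℂ :=
  ∫ ξ, latChar d h z ξ * conj (Φ (h • ξ)) * g ξ

lemma integrable_latChar_mul (d : ℕ) (h : ℝ) {Φ g : Euc d → ℂ} (hΦc : Continuous Φ)
    (hΦb : ∀ ξ, ‖Φ ξ‖ ≤ 1) (hg : Integrable g) (z : Zd d) :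
    Integrable fun ξ => latChar d h z ξ * conj (Φ (h • ξ)) * g ξ := by
  have hc := continuous_latChar d h z
  refine hg.bdd_mul (c := 1) (Continuous.aestronglyMeasurable ?_) (.of_forall fun ξ => ?_)
  · exact hc.mul (Complex.continuous_conj.comp (hΦc.comp (continuous_const_smul h)))
  · rw [norm_mul, norm_latChar, one_mul, RCLike.norm_conj]
    exact hΦb _

lemma inner_freqAtom (d : ℕ) {h : ℝ} (hh : 0 < h) {Φ : Euc d → ℂ} (hΦc : Continuous Φ)
    (hΦ : MemLp Φ 2 volume) {g : Euc d → ℂ} (hg : MemLp g 2 volume) (z : Zd d) :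
    inner ℂ ((memLp_freqAtom d hh hΦc hΦ z).toLp _) (hg.toLp g) =
      (√(h ^ d) : ℂ) * projCoeff d h Φ g z := by
  rw [MeasureTheory.L2.inner_def, projCoeff, ← integral_const_mul]
  refine integral_congr_ae ?_
  filter_upwards [(memLp_freqAtom d hh hΦc hΦ z).coeFn_toLp, hg.coeFn_toLp] with ξ h1 h2
  rw [h1, h2, RCLike.inner_apply, freqAtom]
  simp only [map_mul, Complex.conj_conj, Complex.conj_ofReal]
  ring

lemma norm_sq_inner_freqAtom (d : ℕ) {h : ℝ} (hh : 0 < h) {Φ : Euc d → ℂ} (hΦc : Continuous Φ)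
    (hΦ : MemLp Φ 2 volume) {g : Euc d → ℂ} (hg : MemLp g 2 volume) (z : Zd d) :
    ‖inner ℂ ((memLp_freqAtom d hh hΦc hΦ z).toLp _) (hg.toLp g)‖ ^ 2 =
      h ^ d * ‖projCoeff d h Φ g z‖ ^ 2 := by
  rw [inner_freqAtom d hh hΦc hΦ, norm_mul, mul_pow, Complex.norm_real, Real.norm_eq_abs, sq_abs,
    Real.sq_sqrt (pow_pos hh d).le]

lemma summable_norm_sq_projCoeff (d : ℕ) {h : ℝ} (hh : 0 < h) {Φ : Euc d → ℂ}
    (hΦc : Continuous Φ) (hΦ : MemLp Φ 2 volume)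
    (hsum : ∀ ξ : Euc d, ∑' n : Zd d, ‖Φ (ξ + latVec d n)‖ ^ 2 = 1)
    {g : Euc d → ℂ} (hg : MemLp g 2 volume) :
    Summable fun z => ‖projCoeff d h Φ g z‖ ^ 2 := by
  have := (orthonormal_freqAtom d hh hΦc hΦ hsum).inner_products_summable (x := hg.toLp g)
  simp only [norm_sq_inner_freqAtom d hh hΦc hΦ hg] at this
  exact (summable_mul_left_iff (pow_pos hh d).ne').mp this

/-- Bessel's inequality for the family `freqAtom`. -/
lemma tsum_norm_sq_projCoeff_le (d : ℕ) {h : ℝ} (hh : 0 < h) {Φ : Euc d → ℂ}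
    (hΦc : Continuous Φ) (hΦ : MemLp Φ 2 volume)
    (hsum : ∀ ξ : Euc d, ∑' n : Zd d, ‖Φ (ξ + latVec d n)‖ ^ 2 = 1)
    {g : Euc d → ℂ} (hg : MemLp g 2 volume) :
    h ^ d * ∑' z, ‖projCoeff d h Φ g z‖ ^ 2 ≤ ‖hg.toLp g‖ ^ 2 := by
  have := (orthonormal_freqAtom d hh hΦc hΦ hsum).tsum_inner_products_le (x := hg.toLp g)
  simpa only [norm_sq_inner_freqAtom d hh hΦc hΦ hg, tsum_mul_left] using this

lemma discreteLaplacian_latChar (d : ℕ) (h : ℝ) (z : Zd d) (ξ : Euc d) :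
    (h ^ 2 : ℂ)⁻¹ * ∑ j : Fin d, (2 * latChar d h z ξ - latChar d h (z + Pi.single j 1) ξ
      - latChar d h (z - Pi.single j 1) ξ) = discreteSymbol d h ξ * latChar d h z ξ := by
  have h1 : ∀ j : Fin d, latChar d h (Pi.single j 1) ξ =
      Complex.exp (((2 * π * (h * ξ j) : ℝ) : ℂ) * I) := by
    intro j
    rw [latChar_eq, Finset.sum_eq_single j]
    · simp
      ring_nf
    · intro i _ hi
      simp [hi]
    · simp
  have h2 : ∀ j : Fin d, latChar d h (Pi.single j 1) ξ + conj (latChar d h (Pi.single j 1) ξ) =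
      ((2 * Real.cos (2 * π * (h * ξ j)) : ℝ) : ℂ) := by
    intro j
    rw [Complex.add_conj, h1, Complex.exp_ofReal_mul_I_re]
  simp only [sub_eq_add_neg z, latChar_add, latChar_neg]
  have h3 : ∀ j : Fin d, 2 * latChar d h z ξ - latChar d h z ξ * latChar d h (Pi.single j 1) ξ -
      latChar d h z ξ * conj (latChar d h (Pi.single j 1) ξ) =
      2 * latChar d h z ξ * ((1 - Real.cos (2 * π * (h * ξ j)) : ℝ) : ℂ) := by
    intro j
    have := h2 j
    push_cast at this ⊢
    linear_combination (-latChar d h z ξ) * this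
  rw [Finset.sum_congr rfl fun j _ => h3 j, ← Finset.mul_sum, ← Complex.ofReal_sum, discreteSymbol,
    Complex.ofReal_mul]
  push_cast
  ring

lemma discreteLaplacian_projCoeff (d : ℕ) (h : ℝ) {Φ g : Euc d → ℂ} (hΦc : Continuous Φ)
    (hΦb : ∀ ξ, ‖Φ ξ‖ ≤ 1) (hg : Integrable g) (z : Zd d) :
    (h ^ 2 : ℂ)⁻¹ * ∑ j : Fin d, (2 * projCoeff d h Φ g z
      - projCoeff d h Φ g (z + Pi.single j 1) - projCoeff d h Φ g (z - Pi.single j 1)) =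
      projCoeff d h Φ (fun ξ => discreteSymbol d h ξ * g ξ) z := by
  set F : Zd d → Euc d → ℂ := fun y ξ => latChar d h y ξ * conj (Φ (h • ξ)) * g ξ with hF
  have hi : ∀ y, Integrable (F y) := integrable_latChar_mul d h hΦc hΦb hg
  have hi2 : ∀ y, Integrable fun ξ => 2 * F z ξ - F y ξ := fun y =>
    ((hi z).const_mul 2).sub (hi y)
  have hi3 : ∀ y y', Integrable fun ξ => 2 * F z ξ - F y ξ - F y' ξ := fun y y' =>
    (hi2 y).sub (hi y')
  calc _ = (h ^ 2 : ℂ)⁻¹ * ∑ j : Fin d, (2 * (∫ ξ, F z ξ) - (∫ ξ, F (z + Pi.single j 1) ξ)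
          - ∫ ξ, F (z - Pi.single j 1) ξ) := rfl
    _ = ∫ ξ, (h ^ 2 : ℂ)⁻¹ * ∑ j : Fin d, (2 * F z ξ - F (z + Pi.single j 1) ξ
          - F (z - Pi.single j 1) ξ) := by
        rw [integral_const_mul, integral_finsetSum _ fun j _ => hi3 _ _]
        congr 1
        refine Finset.sum_congr rfl fun j _ => ?_
        rw [integral_sub (hi2 _) (hi _), integral_sub ((hi z).const_mul 2) (hi _),
          integral_const_mul]
    _ = _ := by
        refine integral_congr_ae (.of_forall fun ξ => ?_)
        have := discreteLaplacian_latChar d h z ξ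
        simp only [hF]
        calc _ = (h ^ 2 : ℂ)⁻¹ * (∑ j : Fin d, (2 * latChar d h z ξ
              - latChar d h (z + Pi.single j 1) ξ - latChar d h (z - Pi.single j 1) ξ)) *
              (conj (Φ (h • ξ)) * g ξ) := by
              rw [mul_assoc ((h ^ 2 : ℂ)⁻¹), Finset.sum_mul]
              congr 1
              refine Finset.sum_congr rfl fun j _ => ?_
              ring
          _ = _ := by
              rw [this]
              ring

lemma fourierInv_conj_translate (d : ℕ) {h : ℝ} (hh : 0 < h) (φ : Euc d → ℂ) (z : Zd d)
    (ξ : Euc d) :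
    𝓕⁻ (fun x => conj (φ (h⁻¹ • (x - latPt d h z)))) ξ =
      (h ^ d : ℂ) * (latChar d h z ξ * conj (𝓕 φ (h • ξ))) := by
  rw [Real.fourierInv_eq', ← integral_add_right_eq_self _ (latPt d h z)]
  set G : Euc d → ℂ := fun y => latChar d h z ξ *
    conj (Complex.exp (((-2 * π * ⟪y, h • ξ⟫_ℝ : ℝ) : ℂ) * I) • φ y) with hG
  have h1 : ∀ x : Euc d, Complex.exp (((2 * π * ⟪x + latPt d h z, ξ⟫_ℝ : ℝ) : ℂ) * I) •
        conj (φ (h⁻¹ • (x + latPt d h z - latPt d h z))) =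
      G (h⁻¹ • x) := by
    intro x
    simp only [hG, add_sub_cancel_right, smul_eq_mul, map_mul, ← Complex.exp_conj, latChar,
      Complex.conj_ofReal, Complex.conj_I, ← mul_assoc, ← Complex.exp_add]
    rw [inner_add_left, real_inner_smul_right, real_inner_smul_left, mul_inv_cancel_left₀ hh.ne']
    congr 2
    push_cast
    ring
  simp only [h1]
  rw [Measure.integral_comp_inv_smul_of_nonneg volume G hh.le, hG, finrank_euclideanSpace_fin,
    integral_const_mul, integral_conj, ← Real.fourier_eq', Complex.real_smul]
  push_cast
  rfl

lemma integral_conj_translate_mul_fourierInv (d : ℕ) {h : ℝ} (hh : 0 < h) {φ g : Euc d → ℂ}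
    (hφ : Integrable φ) (hg : Integrable g) (z : Zd d) :
    (h ^ d : ℂ)⁻¹ * ∫ x, conj (φ (h⁻¹ • (x - latPt d h z))) * 𝓕⁻ g x =
      projCoeff d h (𝓕 φ) g z := by
  have hψ : Integrable fun x => conj (φ (h⁻¹ • (x - latPt d h z))) := by
    have := (hφ.comp_smul (inv_ne_zero hh.ne')).comp_sub_right (latPt d h z)
    exact (LinearIsometryEquiv.integrable_comp_iff Complex.conjLIE).mpr this
  have hflip : (-innerₗ (Euc d)).flip = -innerₗ (Euc d) := by
    ext x y
    simp [real_inner_comm]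
  have key := VectorFourier.integral_fourierIntegral_smul_eq_flip (L := -innerₗ (Euc d))
    (μ := volume) (ν := volume) Real.continuous_fourierChar
    (continuous_inner (𝕜 := ℝ) (E := Euc d)).neg hψ hg
  rw [hflip] at key
  change ∫ ξ, 𝓕⁻ (fun x => conj (φ (h⁻¹ • (x - latPt d h z)))) ξ • g ξ =
    ∫ x, conj (φ (h⁻¹ • (x - latPt d h z))) • 𝓕⁻ g x at key
  simp only [smul_eq_mul] at key
  rw [← key, projCoeff, ← integral_const_mul]
  refine integral_congr_ae (.of_forall fun ξ => ?_)
  have hd : (h ^ d : ℂ) ≠ 0 := pow_ne_zero _ (by exact_mod_cast hh.ne')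
  simp only [fourierInv_conj_translate d hh]
  field_simp

lemma norm_le_one_of_tsum_norm_sq_eq_one {d : ℕ} {Φ : Euc d → ℂ}
    (hsum : ∀ ξ : Euc d, ∑' n : Zd d, ‖Φ (ξ + latVec d n)‖ ^ 2 = 1) (ξ : Euc d) : ‖Φ ξ‖ ≤ 1 := by
  have hs : Summable fun n : Zd d => ‖Φ (ξ + latVec d n)‖ ^ 2 := by
    by_contra hns
    have := hsum ξ
    rw [tsum_eq_zero_of_not_summable hns] at this
    exact zero_ne_one this
  have h0 : latVec d 0 = 0 := by
    ext j
    simp [latVec]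
  have := hs.le_tsum 0 fun n _ => sq_nonneg _
  rw [hsum, h0, add_zero] at this
  exact (sq_le_one_iff₀ (norm_nonneg _)).mp this

lemma proj_apply_eq_projCoeff (d : ℕ) {h : ℝ} (hh : 0 < h) {φ : SchwartzMap (Euc d) ℂ}
    {Ph : L2 d →L[ℂ] l2h d h} (hPh : IsProjOp d h φ Ph) {u : L2 d} {g : Euc d → ℂ}
    (hg : Integrable g) (hu : (u : Euc d → ℂ) =ᵐ[volume] 𝓕⁻ g) (z : Zd d) :
    (Ph u : Zd d → ℂ) z = projCoeff d h (𝓕 ⇑φ) g z := by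
  rw [hPh u z, ← integral_conj_translate_mul_fourierInv d hh φ.integrable hg]
  congr 1
  refine integral_congr_ae ?_
  filter_upwards [hu] with x hx
  rw [hx]

lemma memLp_symbol_mul {d : ℕ} {a : Euc d → ℝ} (ha : Continuous a) (ha0 : ∀ ξ, 0 ≤ a ξ) {μ : ℂ}
    (hμ : ∀ r : ℝ, 0 ≤ r → μ ≠ (r : ℂ)) {p : ℝ≥0∞} {g : Euc d → ℂ} (hg : MemLp g p volume) :
    MemLp (fun ξ => ((a ξ : ℂ) - μ)⁻¹ * g ξ) p volume := by
  obtain ⟨K, hK, hKr⟩ := exists_one_add_le_mul_norm_sub hμ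
  have hne : ∀ ξ, (a ξ : ℂ) - μ ≠ 0 := fun ξ => sub_ne_zero.mpr (hμ _ (ha0 ξ)).symm
  have hc : Continuous fun ξ => ((a ξ : ℂ) - μ)⁻¹ :=
    ((Complex.continuous_ofReal.comp ha).sub continuous_const).inv₀ hne
  refine hg.of_le_mul (c := K) (hc.aestronglyMeasurable.mul hg.1) (.of_forall fun ξ => ?_)
  rw [norm_mul, norm_inv]
  gcongr
  rw [inv_le_iff_one_le_mul₀ (norm_pos_iff.mpr (hne ξ))]
  linarith [hKr _ (ha0 ξ), ha0 ξ]

lemma resolvent_proj_apply (d : ℕ) {h : ℝ} (hh : 0 < h) {μ : ℂ}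
    (hμ : ∀ r : ℝ, 0 ≤ r → μ ≠ (r : ℂ)) {Φ : Euc d → ℂ} (hΦc : Continuous Φ)
    (hΦ : MemLp Φ 2 volume)
    (hsum : ∀ ξ : Euc d, ∑' n : Zd d, ‖Φ (ξ + latVec d n)‖ ^ 2 = 1)
    {H0h Rh : l2h d h →L[ℂ] l2h d h} (hH : IsDiscreteFree d h H0h)
    (hR : ∀ v : l2h d h, Rh (H0h v - μ • v) = v) {g : Euc d → ℂ} (hg1 : Integrable g)
    (hg2 : MemLp g 2 volume) {v : l2h d h}
    (hv : ∀ z, (v : Zd d → ℂ) z = projCoeff d h Φ g z) (z : Zd d) :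
    (Rh v : Zd d → ℂ) z =
      projCoeff d h Φ (fun ξ => ((discreteSymbol d h ξ : ℂ) - μ)⁻¹ * g ξ) z := by
  have hΦb := norm_le_one_of_tsum_norm_sq_eq_one hsum
  set g' : Euc d → ℂ := fun ξ => ((discreteSymbol d h ξ : ℂ) - μ)⁻¹ * g ξ with hg'
  have hg'2 : MemLp g' 2 volume :=
    memLp_symbol_mul (continuous_discreteSymbol d h) (discreteSymbol_nonneg d h) hμ hg2
  have hg'1 : Integrable g' := memLp_one_iff_integrable.mp <|
    memLp_symbol_mul (continuous_discreteSymbol d h) (discreteSymbol_nonneg d h) hμ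
      (memLp_one_iff_integrable.mpr hg1)
  have hmem : MemLp (projCoeff d h Φ g') 2 (latMeas d h) :=
    memLp_latMeas d (summable_norm_sq_projCoeff d hh hΦc hΦ hsum hg'2)
  have hw : ∀ z, (hmem.toLp _ : Zd d → ℂ) z = projCoeff d h Φ g' z :=
    (ae_latMeas_iff d hh).mp hmem.coeFn_toLp
  have hcancel : ∀ ξ, (discreteSymbol d h ξ : ℂ) * g' ξ = μ * g' ξ + g ξ := by
    intro ξ
    have hne : (discreteSymbol d h ξ : ℂ) - μ ≠ 0 :=
      sub_ne_zero.mpr (hμ _ (discreteSymbol_nonneg d h ξ)).symm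
    rw [hg']
    field_simp
    ring
  have hres : H0h (hmem.toLp _) - μ • hmem.toLp _ = v := by
    refine eq_of_isDiscreteFree_resolvent d hH fun z => ?_
    simp only [hw, hv]
    rw [discreteLaplacian_projCoeff d h hΦc hΦb hg'1, sub_eq_iff_eq_add', projCoeff, projCoeff,
      projCoeff, ← integral_const_mul,
      ← integral_add ((integrable_latChar_mul d h hΦc hΦb hg'1 z).const_mul μ)
        (integrable_latChar_mul d h hΦc hΦb hg1 z)]
    refine integral_congr_ae (.of_forall fun ξ => ?_)
    simp only [hcancel]
    ring
  rw [← hres, hR, hw]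

lemma norm_resolvent_proj_sub_apply_le (d : ℕ) {h : ℝ} (hh : 0 < h) {μ : ℂ}
    (hμ : ∀ r : ℝ, 0 ≤ r → μ ≠ (r : ℂ)) {Φ : Euc d → ℂ} (hΦc : Continuous Φ)
    (hΦ : MemLp Φ 2 volume)
    (hsum : ∀ ξ : Euc d, ∑' n : Zd d, ‖Φ (ξ + latVec d n)‖ ^ 2 = 1)
    {H0h Rh : l2h d h →L[ℂ] l2h d h} (hH : IsDiscreteFree d h H0h)
    (hR : ∀ v : l2h d h, Rh (H0h v - μ • v) = v) {g : Euc d → ℂ} (hg1 : Integrable g)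
    (hg2 : MemLp g 2 volume) {v v₀ : l2h d h}
    (hv : ∀ z, (v : Zd d → ℂ) z = projCoeff d h Φ g z)
    (hv₀ : ∀ z, (v₀ : Zd d → ℂ) z =
      projCoeff d h Φ (fun ξ => ((freeSymbol d ξ : ℂ) - μ)⁻¹ * g ξ) z)
    {B : ℝ} (hB0 : 0 ≤ B) (hB : ∀ ξ, Φ (h • ξ) ≠ 0 →
      ‖((discreteSymbol d h ξ : ℂ) - μ)⁻¹ - ((freeSymbol d ξ : ℂ) - μ)⁻¹‖ ≤ B) :
    ‖Rh v - v₀‖ ≤ B * ‖hg2.toLp g‖ := by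
  have hΦb := norm_le_one_of_tsum_norm_sq_eq_one hsum
  set m : Euc d → ℂ := fun ξ =>
    ((discreteSymbol d h ξ : ℂ) - μ)⁻¹ - ((freeSymbol d ξ : ℂ) - μ)⁻¹ with hm
  set S : Set (Euc d) := {ξ | Φ (h • ξ) ≠ 0} with hS
  have hSm : MeasurableSet S :=
    (isOpen_ne_fun (hΦc.comp (continuous_const_smul h)) continuous_const).measurableSet
  have hdisc : ∀ {p : ℝ≥0∞}, MemLp g p volume →
      MemLp (fun ξ => ((discreteSymbol d h ξ : ℂ) - μ)⁻¹ * g ξ) p volume :=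
    memLp_symbol_mul (continuous_discreteSymbol d h) (discreteSymbol_nonneg d h) hμ
  have hfree : ∀ {p : ℝ≥0∞}, MemLp g p volume →
      MemLp (fun ξ => ((freeSymbol d ξ : ℂ) - μ)⁻¹ * g ξ) p volume :=
    memLp_symbol_mul (continuous_freeSymbol d) (freeSymbol_nonneg d) hμ
  have hk : MemLp (S.indicator fun ξ => m ξ * g ξ) 2 volume := by
    refine MemLp.indicator hSm ?_
    simpa only [hm, sub_mul] using! (hdisc hg2).sub (hfree hg2)
  have hz : ∀ z, ((Rh v - v₀ : l2h d h) : Zd d → ℂ) z =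
      projCoeff d h Φ (S.indicator fun ξ => m ξ * g ξ) z := by
    intro z
    rw [(ae_latMeas_iff d hh).mp (Lp.coeFn_sub (Rh v) v₀) z, Pi.sub_apply,
      resolvent_proj_apply d hh hμ hΦc hΦ hsum hH hR hg1 hg2 hv, hv₀, projCoeff, projCoeff,
      projCoeff, ← integral_sub
        (integrable_latChar_mul d h hΦc hΦb
          (memLp_one_iff_integrable.mp (hdisc (memLp_one_iff_integrable.mpr hg1))) z)
        (integrable_latChar_mul d h hΦc hΦb
          (memLp_one_iff_integrable.mp (hfree (memLp_one_iff_integrable.mpr hg1))) z)]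
    refine integral_congr_ae (.of_forall fun ξ => ?_)
    by_cases hξ : Φ (h • ξ) = 0
    · simp [hξ]
    · have : ξ ∈ S := hξ
      simp only [Set.indicator_of_mem this, hm]
      ring
  have hle : ‖hk.toLp _‖ ≤ B * ‖hg2.toLp g‖ := by
    refine Lp.norm_le_mul_norm_of_ae_le_mul ?_
    filter_upwards [hk.coeFn_toLp, hg2.coeFn_toLp] with ξ h1 h2
    rw [h1, h2]
    by_cases hξ : ξ ∈ S
    · rw [Set.indicator_of_mem hξ, norm_mul]
      gcongr
      exact hB ξ hξ
    · rw [Set.indicator_of_notMem hξ, norm_zero]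
      positivity
  refine le_trans ((sq_le_sq₀ (norm_nonneg _) (norm_nonneg _)).mp ?_) hle
  rw [l2h_norm_sq d hh]
  simp only [hz]
  exact tsum_norm_sq_projCoeff_le d hh hΦc hΦ hsum hk

/-- Suppose `φ` satisfies Assumption (φ).  For every `μ ∈ ℂ \ [0,∞)` there
is `C > 0` such that `‖(H_{0,h} − μ)⁻¹ P_h − P_h (H₀ − μ)⁻¹‖_{B(L²(ℝ^d),ℓ²(hℤ^d))} ≤ C h²`
for all `h > 0`, where `(H₀ − μ)⁻¹` is the Fourier multiplier with symbol
`ξ ↦ (|2πξ|² − μ)⁻¹` and `(H_{0,h} − μ)⁻¹` is the (bounded) inverse of `H_{0,h} − μ`. -/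
theorem discrete_free_resolvent_projection_bound
    (d : ℕ) (φ : SchwartzMap (Euc d) ℂ)
    (hφ1 : ∀ ξ : Euc d, ∑' n : Zd d, ‖𝓕 ⇑φ (ξ + latVec d n)‖ ^ 2 = 1)
    (hφ2 : tsupport (𝓕 ⇑φ) ⊆ {ξ : Euc d | ∀ j, ξ j ∈ Set.Ioo (-1 : ℝ) 1})
    (μ : ℂ) (hμ : ∀ r : ℝ, 0 ≤ r → μ ≠ (r : ℂ))
    (R0 : L2 d →L[ℂ] L2 d)
    (hR0 : ∀ (f : SchwartzMap (Euc d) ℂ) (hf : MemLp ⇑f 2 (volume : Measure (Euc d))),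
      (R0 (hf.toLp ⇑f) : Euc d → ℂ) =ᵐ[volume]
        fun x => ∫ ξ, Complex.exp (2 * π * Complex.I * (⟪x, ξ⟫_ℝ : ℂ)) *
          (((‖(2 * π) • ξ‖ ^ 2 : ℝ) : ℂ) - μ)⁻¹ * 𝓕 ⇑f ξ) :
    ∃ C > (0 : ℝ), ∀ h : ℝ, 0 < h →
      ∀ Ph : L2 d →L[ℂ] l2h d h, IsProjOp d h φ Ph →
      ∀ H0h : l2h d h →L[ℂ] l2h d h, IsDiscreteFree d h H0h →
      ∀ Rh : l2h d h →L[ℂ] l2h d h,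
        (∀ v : l2h d h, H0h (Rh v) - μ • Rh v = v) →
        (∀ v : l2h d h, Rh (H0h v - μ • v) = v) →
        ‖Rh.comp Ph - Ph.comp R0‖ ≤ C * h ^ 2 := by
  obtain ⟨δ, hδ, hδΦ⟩ := exists_forall_abs_le_of_tsupport_subset hφ2
  obtain ⟨C, hC, hCm⟩ := exists_norm_resolventSymbol_sub_le d hμ hδ
  refine ⟨C, hC, fun h hh Ph hPh H0h hH Rh _ hR => ?_⟩
  have hΦc : Continuous (𝓕 ⇑φ) := (𝓕 φ).continuous
  have hΦ : MemLp (𝓕 ⇑φ) 2 volume := (𝓕 φ).memLp 2 volume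
  refine ContinuousLinearMap.opNorm_le_bound _ (by positivity) fun u => ?_
  refine (SchwartzMap.denseRange_toLpCLM (F := ℂ) (p := 2) (μ := (volume : Measure (Euc d)))
    (by simp)).induction_on u (isClosed_le (by fun_prop) (by fun_prop)) fun f => ?_
  rw [SchwartzMap.toLpCLM_apply]
  have hg1 : Integrable (𝓕 ⇑f) := (𝓕 f).integrable
  have hg2 : MemLp (𝓕 ⇑f) 2 volume := (𝓕 f).memLp 2 volume
  have hf : (f.toLp 2 volume : Euc d → ℂ) =ᵐ[volume] 𝓕⁻ (𝓕 ⇑f) := by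
    rw [f.continuous.fourierInv_fourier_eq f.integrable hg1]
    exact f.coeFn_toLp 2
  have hR0f : (R0 (f.toLp 2 volume) : Euc d → ℂ) =ᵐ[volume]
      𝓕⁻ fun ξ => ((freeSymbol d ξ : ℂ) - μ)⁻¹ * 𝓕 ⇑f ξ := by
    refine (hR0 f (f.memLp 2)).trans (.of_forall fun x => ?_)
    simp only [Real.fourierInv_eq', smul_eq_mul]
    refine integral_congr_ae (.of_forall fun ξ => ?_)
    simp only [freeSymbol, real_inner_comm x ξ]
    push_cast
    ring_nf
  have hfree1 : Integrable fun ξ => ((freeSymbol d ξ : ℂ) - μ)⁻¹ * 𝓕 ⇑f ξ :=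
    memLp_one_iff_integrable.mp <| memLp_symbol_mul (continuous_freeSymbol d)
      (freeSymbol_nonneg d) hμ (memLp_one_iff_integrable.mpr hg1)
  have key := norm_resolvent_proj_sub_apply_le d hh hμ hΦc hΦ hφ1 hH hR hg1 hg2
    (proj_apply_eq_projCoeff d hh hPh hg1 hf) (proj_apply_eq_projCoeff d hh hPh hfree1 hR0f)
    (by positivity) fun ξ hξ => hCm h hh ξ fun j => by simpa using hδΦ _ hξ j
  have hnorm : ‖hg2.toLp (𝓕 ⇑f)‖ = ‖f.toLp 2 volume‖ := SchwartzMap.norm_fourier_toL2_eq f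
  rw [hnorm] at key
  exact key
end
end
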